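/- There exists a universal constant C > 0 such that for every dimension n ≥ 1, L_n ≤ C σ_n. -/

import Mathlib

open MeasureTheory Real Set Filter Topology RealInnerProductSpace
noncomputable section

abbrev EucSp (n : ℕ) := EuclideanSpace ℝ (Fin n)

/-- A nonnegative function is log-concave. -/
def IsLogConcaveFn {n : ℕ} (f : EucSp n → ℝ) : Prop :=
  (∀ x, 0 ≤ f x) ∧ ∀ x y : EucSp n, ∀ l : ℝ, l ∈ Set.Icc (0:ℝ) 1 →
    f x ^ (1 - l) * f y ^ l ≤ f ((1 - l) • x + l • y)

/-- A measure is log-concave if it has a log-concave density w.r.t. Lebesgue measure. -/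
def IsLogConcave {n : ℕ} (μ : Measure (EucSp n)) : Prop :=
  ∃ f : EucSp n → ℝ, IsLogConcaveFn f ∧
    μ = volume.withDensity (fun x => ENNReal.ofReal (f x))

/-- Barycenter at the origin and covariance matrix equal to the identity. -/
def IsIsotropic {n : ℕ} (μ : Measure (EucSp n)) : Prop :=
  (∫ x, x ∂μ = 0) ∧ ∀ u v : EucSp n, (∫ x, ⟪x, u⟫ * ⟪x, v⟫ ∂μ) = ⟪u, v⟫

/-- σ_n² = sup over isotropic log-concave random vectors of E (|X| - √n)². -/
def sigmaNSq (n : ℕ) : ℝ :=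
  sSup {v | ∃ μ : Measure (EucSp n), IsProbabilityMeasure μ ∧ IsIsotropic μ ∧
    IsLogConcave μ ∧ v = ∫ x, (‖x‖ - Real.sqrt n) ^ 2 ∂μ}

def sigmaN (n : ℕ) : ℝ := Real.sqrt (sigmaNSq n)

/-- σ̲_n = (1/√n) sup over isotropic log-concave random vectors of |E X |X|²|. -/
def sigmaBar (n : ℕ) : ℝ :=
  (Real.sqrt n)⁻¹ * sSup {v | ∃ μ : Measure (EucSp n), IsProbabilityMeasure μ ∧
    IsIsotropic μ ∧ IsLogConcave μ ∧ v = ‖∫ x, (‖x‖ ^ 2) • x ∂μ‖}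

/-- L_n = sup over isotropic log-concave probability densities f on ℝⁿ of f(0)^{1/n}. -/
def LN (n : ℕ) : ℝ :=
  sSup {l | ∃ (μ : Measure (EucSp n)) (f : EucSp n → ℝ),
    IsProbabilityMeasure μ ∧ IsIsotropic μ ∧ IsLogConcaveFn f ∧
    μ = volume.withDensity (fun x => ENNReal.ofReal (f x)) ∧
    l = f 0 ^ ((n : ℝ)⁻¹)}

open scoped ENNReal

/-- One-dimensional Brunn–Minkowski inequality. -/
lemma Real.volume_add_le_of_add_mem {A B T : Set ℝ} (hA : MeasurableSet A) (hB : MeasurableSet B)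
    (hA0 : A.Nonempty) (hB0 : B.Nonempty) (hT : ∀ a ∈ A, ∀ b ∈ B, a + b ∈ T) :
    volume A + volume B ≤ volume T := by
  have key : ∀ K ⊆ A, IsCompact K → ∀ L ⊆ B, IsCompact L → K.Nonempty → L.Nonempty →
      volume K + volume L ≤ volume T := by
    intro K hKA hK L hLB hL hK0 hL0
    have ha := hK.sSup_mem hK0
    have hb := hL.sInf_mem hL0
    have hK1 : volume ((fun x => x + -sInf L) ⁻¹' K) = volume K :=
      measure_preimage_add_right _ _ _
    have hL1 : volume ((fun x => x + -sSup K) ⁻¹' L) = volume L :=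
      measure_preimage_add_right _ _ _
    rw [← hK1, ← hL1, ← measure_union₀']
    · apply measure_mono
      rintro x (hx | hx)
      · have := hT _ (hKA hx) _ (hLB hb)
        simpa using this
      · have := hT _ (hKA ha) _ (hLB hx)
        simpa [add_comm] using this
    · exact (hK.measurableSet.preimage (by fun_prop)).nullMeasurableSet
    · refine measure_mono_null ?_ (measure_singleton (sSup K + sInf L))
      rintro x ⟨h1, h2⟩
      have h3 := le_csSup hK.bddAbove h1
      have h4 := csInf_le hL.bddBelow h2
      simp only [mem_singleton_iff]
      linarith
  obtain ⟨a, ha⟩ := hA0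
  obtain ⟨b, hb⟩ := hB0
  have key2 : ∀ K ⊆ A, IsCompact K → ∀ L ⊆ B, IsCompact L →
      volume K + volume L ≤ volume T := by
    intro K hKA hK L hLB hL
    refine le_trans (add_le_add (measure_mono (subset_insert a K)) (measure_mono (subset_insert b L)))
      (key _ (insert_subset ha hKA) (hK.insert a) _ (insert_subset hb hLB) (hL.insert b)
        (insert_nonempty _ _) (insert_nonempty _ _))
  rw [hA.measure_eq_iSup_isCompact, hB.measure_eq_iSup_isCompact]
  simp only [iSup_and']
  exact ENNReal.biSup_add_biSup_le' (p := fun K => K ⊆ A ∧ IsCompact K)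
    (q := fun L => L ⊆ B ∧ IsCompact L) ⟨∅, by simp⟩ ⟨∅, by simp⟩
    fun K hK L hL => key2 K hK.1 hK.2 L hL.1 hL.2

lemma ENNReal.mul_le_sq_of_add_le {x y z : ℝ≥0∞} (h : x + y ≤ 2 * z) : x * y ≤ z ^ 2 := by
  rcases eq_or_ne z ⊤ with rfl | hz
  · simp
  have hx : x ≠ ⊤ := fun hx => by
    rw [hx, top_add, top_le_iff] at h
    exact ENNReal.mul_ne_top (by simp) hz h
  have hy : y ≠ ⊤ := fun hy => by
    rw [hy, add_top, top_le_iff] at h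
    exact ENNReal.mul_ne_top (by simp) hz h
  lift x to NNReal using hx
  lift y to NNReal using hy
  lift z to NNReal using hz
  norm_cast at h ⊢
  rw [← NNReal.coe_le_coe] at h ⊢
  push_cast at h ⊢
  nlinarith [sq_nonneg ((x:ℝ) - y), x.2, y.2, z.2]

lemma lintegral_add_le_of_forall_sup_eq_one {f g h : ℝ → ℝ} (hf : Measurable f) (hg : Measurable g)
    (hh : Measurable h) (hf0 : ∀ x, 0 ≤ f x) (hg0 : ∀ x, 0 ≤ g x) (hh0 : ∀ x, 0 ≤ h x)
    (hf1 : ∀ x, f x ≤ 1) (hg1 : ∀ x, g x ≤ 1) (hfs : ∀ t < 1, ∃ x, t < f x)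
    (hgs : ∀ t < 1, ∃ x, t < g x) (H : ∀ x y, f x * g y ≤ h ((x + y) / 2) ^ 2) :
    (∫⁻ x, ENNReal.ofReal (f x)) + ∫⁻ x, ENNReal.ofReal (g x) ≤
      2 * ∫⁻ x, ENNReal.ofReal (h x) := by
  rw [lintegral_eq_lintegral_meas_lt _ (ae_of_all _ hf0) hf.aemeasurable,
    lintegral_eq_lintegral_meas_lt _ (ae_of_all _ hg0) hg.aemeasurable,
    lintegral_eq_lintegral_meas_lt _ (ae_of_all _ hh0) hh.aemeasurable]
  have hmeas : ∀ u : ℝ → ℝ, Measurable fun t : ℝ => volume {a : ℝ | t < u a} := fun u =>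
    Antitone.measurable fun s t hst => measure_mono fun a ha => lt_of_le_of_lt hst ha
  rw [← lintegral_add_left (hmeas f), ← lintegral_const_mul _ (hmeas h)]
  refine setLIntegral_mono ((hmeas h).const_mul _) fun t (ht : 0 < t) => ?_
  rcases lt_or_ge t 1 with h1 | h1
  · have := Real.volume_add_le_of_add_mem (T := (fun z => (2:ℝ)⁻¹ * z) ⁻¹' {a | t < h a})
      (measurableSet_lt measurable_const hf)
      (measurableSet_lt measurable_const hg) (hfs t h1) (hgs t h1) (fun a ha b hb => by
        simp only [mem_preimage, mem_ofPred_eq] at ha hb ⊢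
        have h2 := H a b
        have h3 : t ^ 2 < f a * g b := by nlinarith
        have h4 : (2:ℝ)⁻¹ * (a + b) = (a + b) / 2 := by ring
        rw [h4]
        exact lt_of_pow_lt_pow_left₀ 2 (hh0 _) (h3.trans_le h2))
    rw [Real.volume_preimage_mul_left (by norm_num)] at this
    simpa using this
  · have e1 : {a | t < f a} = ∅ := by
      ext a; simpa using (hf1 a).trans h1
    have e2 : {a | t < g a} = ∅ := by
      ext a; simpa using (hg1 a).trans h1
    simp [e1, e2]

lemma lintegral_mul_le_sq_of_bounded {f g h : ℝ → ℝ} (hf : Measurable f) (hg : Measurable g)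
    (hh : Measurable h) (hf0 : ∀ x, 0 ≤ f x) (hg0 : ∀ x, 0 ≤ g x) (hh0 : ∀ x, 0 ≤ h x)
    {N : ℝ} (hf1 : ∀ x, f x ≤ N) (hg1 : ∀ x, g x ≤ N)
    (H : ∀ x y, f x * g y ≤ h ((x + y) / 2) ^ 2) :
    (∫⁻ x, ENNReal.ofReal (f x)) * ∫⁻ x, ENNReal.ofReal (g x) ≤
      (∫⁻ x, ENNReal.ofReal (h x)) ^ 2 := by
  have bf : BddAbove (range f) := ⟨N, by rintro _ ⟨x, rfl⟩; exact hf1 x⟩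
  have bg : BddAbove (range g) := ⟨N, by rintro _ ⟨x, rfl⟩; exact hg1 x⟩
  set a := ⨆ x, f x with ha
  set b := ⨆ x, g x with hb
  have fa : ∀ x, f x ≤ a := fun x => le_ciSup bf x
  have gb : ∀ x, g x ≤ b := fun x => le_ciSup bg x
  have ha0 : 0 ≤ a := (hf0 0).trans (fa 0)
  have hb0 : 0 ≤ b := (hg0 0).trans (gb 0)
  rcases ha0.eq_or_lt with ha0 | ha0
  · have : ∀ x, f x = 0 := fun x => le_antisymm (ha0 ▸ fa x) (hf0 x)
    simp [this]
  rcases hb0.eq_or_lt with hb0 | hb0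
  · have : ∀ x, g x = 0 := fun x => le_antisymm (hb0 ▸ gb x) (hg0 x)
    simp [this]
  have hc : 0 < √(a * b) := Real.sqrt_pos.2 (mul_pos ha0 hb0)
  have hc2 : √(a * b) ^ 2 = a * b := Real.sq_sqrt (mul_pos ha0 hb0).le
  set c := √(a * b)
  have key := lintegral_add_le_of_forall_sup_eq_one (f := fun x => f x / a) (g := fun x => g x / b)
    (h := fun x => h x / c) (hf.div_const _) (hg.div_const _) (hh.div_const _)
    (fun x => div_nonneg (hf0 x) ha0.le) (fun x => div_nonneg (hg0 x) hb0.le)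
    (fun x => div_nonneg (hh0 x) hc.le) (fun x => (div_le_one ha0).2 (fa x))
    (fun x => (div_le_one hb0).2 (gb x))
    (fun t ht => by
      obtain ⟨x, hx⟩ := exists_lt_of_lt_ciSup (show t * a < ⨆ x, f x by rw [← ha]; nlinarith)
      exact ⟨x, (lt_div_iff₀ ha0).2 hx⟩)
    (fun t ht => by
      obtain ⟨x, hx⟩ := exists_lt_of_lt_ciSup (show t * b < ⨆ x, g x by rw [← hb]; nlinarith)
      exact ⟨x, (lt_div_iff₀ hb0).2 hx⟩)
    (fun x y => by
      rw [div_mul_div_comm, div_pow, hc2]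
      exact div_le_div_of_nonneg_right (H x y) (mul_pos ha0 hb0).le)
  have key2 := ENNReal.mul_le_sq_of_add_le key
  have e : ∀ (u : ℝ → ℝ) (d : ℝ), 0 < d → Measurable u → ∫⁻ x, ENNReal.ofReal (u x) =
      ENNReal.ofReal d * ∫⁻ x, ENNReal.ofReal (u x / d) := by
    intro u d hd hu
    rw [← lintegral_const_mul _ (hu.div_const d).ennreal_ofReal]
    congr 1
    ext x
    rw [← ENNReal.ofReal_mul hd.le]
    congr 1
    field_simp
  rw [e f a ha0 hf, e g b hb0 hg, e h c hc hh, mul_pow, mul_mul_mul_comm,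
    ← ENNReal.ofReal_mul ha0.le, ← ENNReal.ofReal_pow hc.le, hc2]
  gcongr

/-- The (midpoint) Prékopa–Leindler inequality on the line. -/
lemma prekopaLeindler_real {f g h : ℝ → ℝ≥0∞} (hf : Measurable f) (hg : Measurable g)
    (hh : Measurable h) (H : ∀ x y, f x * g y ≤ h ((x + y) / 2) ^ 2) :
    (∫⁻ x, f x) * ∫⁻ x, g x ≤ (∫⁻ x, h x) ^ 2 := by
  have key : ∀ N : ℕ, (∫⁻ x, min (f x) N) * ∫⁻ x, min (g x) N ≤ (∫⁻ x, h x) ^ 2 := by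
    intro N
    have fin : ∀ u : ℝ≥0∞, min u N ≠ ⊤ := fun u =>
      ne_top_of_le_ne_top (ENNReal.natCast_ne_top N) (min_le_right _ _)
    have le : ∀ u : ℝ≥0∞, (min u N).toReal ≤ N := fun u =>
      ENNReal.toReal_le_of_le_ofReal (by positivity) (by simp)
    have := lintegral_mul_le_sq_of_bounded (f := fun x => (min (f x) N).toReal)
      (g := fun x => (min (g x) N).toReal) (h := fun x => (min (h x) N).toReal) (N := N)
      (hf.min measurable_const).ennreal_toReal (hg.min measurable_const).ennreal_toReal
      (hh.min measurable_const).ennreal_toReal (fun _ => ENNReal.toReal_nonneg)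
      (fun _ => ENNReal.toReal_nonneg) (fun _ => ENNReal.toReal_nonneg) (fun _ => le _)
      (fun _ => le _) (fun x y => by
        rw [← ENNReal.toReal_mul, ← ENNReal.toReal_pow]
        refine ENNReal.toReal_mono (ENNReal.pow_ne_top (fin _)) ?_
        rcases le_total (h ((x + y) / 2)) N with h1 | h1
        · rw [min_eq_left h1]
          exact (mul_le_mul' (min_le_left _ _) (min_le_left _ _)).trans (H x y)
        · rw [min_eq_right h1, sq]
          exact mul_le_mul' (min_le_right _ _) (min_le_right _ _))
    simp only [ENNReal.ofReal_toReal (fin _)] at this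
    refine this.trans ?_
    gcongr
    exact min_le_left _ _
  have lim : ∀ u : ℝ → ℝ≥0∞, Measurable u → ∫⁻ x, u x = ⨆ N : ℕ, ∫⁻ x, min (u x) N := by
    intro u hu
    rw [← lintegral_iSup (fun N => hu.min measurable_const)
      (fun i j hij x => min_le_min_left _ (by exact_mod_cast hij))]
    congr 1
    ext x
    rw [← inf_iSup_eq (u x) (fun N : ℕ => (N : ℝ≥0∞)), ENNReal.iSup_natCast, inf_top_eq]
  rw [lim f hf, lim g hg, ENNReal.iSup_mul]
  refine iSup_le fun N => ?_
  rw [ENNReal.mul_iSup]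
  refine iSup_le fun M => ?_
  refine le_trans (mul_le_mul' ?_ ?_) (key (max N M))
  · exact lintegral_mono fun x => min_le_min_left _ (by exact_mod_cast le_max_left _ _)
  · exact lintegral_mono fun x => min_le_min_left _ (by exact_mod_cast le_max_right _ _)

lemma prekopaLeindler_pi : ∀ (n : ℕ) {f g h : (Fin n → ℝ) → ℝ≥0∞}, Measurable f →
    Measurable g → Measurable h → (∀ x y, f x * g y ≤ h ((2:ℝ)⁻¹ • (x + y)) ^ 2) →
    (∫⁻ x, f x) * ∫⁻ x, g x ≤ (∫⁻ x, h x) ^ 2 := by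
  intro n
  induction n with
  | zero =>
    intro f g h _ _ _ H
    simp only [volume_pi, Measure.pi_of_empty (μ := fun _ : Fin 0 => (volume : Measure ℝ)) 0,
      lintegral_dirac]
    simpa using H 0 0
  | succ n ih =>
    intro f g h hf hg hh H
    have e := (volume_preserving_piFinSuccAbove (fun _ : Fin (n + 1) => ℝ) 0).symm
    rw [← e.lintegral_comp hf, ← e.lintegral_comp hg, ← e.lintegral_comp hh]
    have ms : ∀ u : (Fin (n + 1) → ℝ) → ℝ≥0∞, Measurable u →
        Measurable fun p : ℝ × (Fin n → ℝ) =>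
          u ((MeasurableEquiv.piFinSuccAbove (fun _ : Fin (n + 1) => ℝ) 0).symm p) :=
      fun u hu => hu.comp (MeasurableEquiv.measurable _)
    rw [Measure.volume_eq_prod, lintegral_prod _ (ms f hf).aemeasurable,
      lintegral_prod _ (ms g hg).aemeasurable, lintegral_prod _ (ms h hh).aemeasurable]
    refine prekopaLeindler_real (ms f hf).lintegral_prod_right'
      (ms g hg).lintegral_prod_right' (ms h hh).lintegral_prod_right' fun a b => ?_
    refine ih ((ms f hf).comp measurable_prodMk_left) ((ms g hg).comp measurable_prodMk_left)
      ((ms h hh).comp measurable_prodMk_left) fun x y => ?_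
    refine (H _ _).trans_eq ?_
    congr 2
    ext i
    refine Fin.cases ?_ (fun j => ?_) i
    · simp [MeasurableEquiv.piFinSuccAbove, Fin.insertNthEquiv]
      ring
    · simp [MeasurableEquiv.piFinSuccAbove, Fin.insertNthEquiv]
      ring

/-- The (midpoint) Prékopa–Leindler inequality in Euclidean space. -/
lemma prekopaLeindler {n : ℕ} {f g h : EucSp n → ℝ≥0∞} (hh : AEMeasurable h)
    (H : ∀ x y, f x * g y ≤ h ((2:ℝ)⁻¹ • (x + y)) ^ 2) :
    (∫⁻ x, f x) * ∫⁻ x, g x ≤ (∫⁻ x, h x) ^ 2 := by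
  obtain ⟨f', hf', hff, ef⟩ := exists_measurable_le_lintegral_eq volume f
  obtain ⟨g', hg', hgg, eg⟩ := exists_measurable_le_lintegral_eq volume g
  obtain ⟨N, hN, hN', N0⟩ := exists_measurable_superset_of_null hh.ae_eq_mk
  classical
  set h' : EucSp n → ℝ≥0∞ := N.piecewise (fun _ => ⊤) (hh.mk h) with hdef
  have hh' : Measurable h' := measurable_const.piecewise hN' hh.measurable_mk
  have hle : ∀ x, h x ≤ h' x := by
    intro x
    by_cases hx : x ∈ N
    · simp [hdef, hx]
    · have : h x = hh.mk h x := by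
        by_contra h1
        exact hx (hN h1)
      simp [hdef, hx, this]
  have eh : ∫⁻ x, h x = ∫⁻ x, h' x := by
    refine lintegral_congr_ae ?_
    filter_upwards [hh.ae_eq_mk, compl_mem_ae_iff.2 N0] with x h1 h2
    have h3 : x ∉ N := h2
    simp [hdef, h3, h1]
  rw [ef, eg, eh]
  have e := (EuclideanSpace.volume_preserving_symm_measurableEquiv_toLp (Fin n)).symm
  rw [← e.lintegral_comp hf', ← e.lintegral_comp hg', ← e.lintegral_comp hh']
  refine prekopaLeindler_pi n (hf'.comp (MeasurableEquiv.measurable _))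
    (hg'.comp (MeasurableEquiv.measurable _)) (hh'.comp (MeasurableEquiv.measurable _)) fun x y => ?_
  refine (mul_le_mul' (hff _) (hgg _)).trans ((H _ _).trans ?_)
  gcongr
  exact hle _

namespace IsLogConcaveFn

variable {n : ℕ} {f : EucSp n → ℝ}

lemma convex_superlevel (hf : IsLogConcaveFn f) {c : ℝ} (hc : 0 < c) :
    Convex ℝ {x | c ≤ f x} := by
  intro x (hx : c ≤ f x) y (hy : c ≤ f y) a b ha hb hab
  obtain rfl : a = 1 - b := by linarith
  refine le_trans ?_ (hf.2 x y b ⟨hb, by linarith⟩)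
  calc c = c ^ (1 - b) * c ^ b := by rw [← Real.rpow_add hc]; simp
    _ ≤ _ := by gcongr; exact Real.rpow_nonneg (hf.1 x) _

lemma aemeasurable (hf : IsLogConcaveFn f) : AEMeasurable f := by
  refine NullMeasurable.aemeasurable ?_
  have : ∀ c : ℝ, NullMeasurableSet {x | c ≤ f x} (volume : Measure (EucSp n)) := by
    intro c
    rcases lt_or_ge 0 c with hc | hc
    · exact (hf.convex_superlevel hc).nullMeasurableSet _
    · have : {x | c ≤ f x} = univ := by ext x; simpa using hc.trans (hf.1 x)
      rw [this]; exact nullMeasurableSet_univ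
  have h2 : @Measurable (NullMeasurableSpace (EucSp n) volume) ℝ _ _ f :=
    measurable_of_Ici fun c => this c
  exact h2

lemma mul_le_sq (hf : IsLogConcaveFn f) (x y : EucSp n) :
    f x * f y ≤ f ((2:ℝ)⁻¹ • (x + y)) ^ 2 := by
  have h := hf.2 x y (1/2) ⟨by norm_num, by norm_num⟩
  have e : (1 - (1/2:ℝ)) • x + (1/2:ℝ) • y = (2:ℝ)⁻¹ • (x + y) := by
    rw [smul_add]; norm_num
  rw [e] at h
  calc f x * f y = (f x ^ (1 - (1/2:ℝ)) * f y ^ (1/2:ℝ)) ^ 2 := by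
        rw [show (1 - (1/2:ℝ)) = 1/2 by norm_num, ← Real.sqrt_eq_rpow, ← Real.sqrt_eq_rpow, mul_pow,
          Real.sq_sqrt (hf.1 x), Real.sq_sqrt (hf.1 y)]
    _ ≤ _ := by
        have := mul_nonneg (Real.rpow_nonneg (hf.1 x) (1 - (1/2:ℝ)))
          (Real.rpow_nonneg (hf.1 y) (1/2:ℝ))
        gcongr

lemma prekopaLeindler_withDensity (hf : IsLogConcaveFn f) {u v w : EucSp n → ℝ≥0∞}
    (hu : Measurable u) (hv : Measurable v) (hw : Measurable w)
    (H : ∀ x y, u x * v y ≤ w ((2:ℝ)⁻¹ • (x + y)) ^ 2) :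
    (∫⁻ x, u x ∂(volume.withDensity fun x => ENNReal.ofReal (f x))) *
      (∫⁻ x, v x ∂(volume.withDensity fun x => ENNReal.ofReal (f x))) ≤
      (∫⁻ x, w x ∂(volume.withDensity fun x => ENNReal.ofReal (f x))) ^ 2 := by
  have hm := hf.aemeasurable.ennreal_ofReal
  rw [lintegral_withDensity_eq_lintegral_mul₀ hm hu.aemeasurable,
    lintegral_withDensity_eq_lintegral_mul₀ hm hv.aemeasurable,
    lintegral_withDensity_eq_lintegral_mul₀ hm hw.aemeasurable]
  refine prekopaLeindler (hm.mul hw.aemeasurable) fun x y => ?_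
  simp only [Pi.mul_apply]
  rw [mul_mul_mul_comm, mul_pow, ← ENNReal.ofReal_mul (hf.1 x), ← ENNReal.ofReal_pow (hf.1 _)]
  gcongr
  · exact hf.mul_le_sq x y
  · exact H x y

end IsLogConcaveFn

namespace IsIsotropic

variable {n : ℕ} {μ : Measure (EucSp n)}

lemma integrable_inner_mul_self (h : IsIsotropic μ) (u : EucSp n) :
    Integrable (fun x => ⟪x, u⟫ * ⟪x, u⟫) μ := by
  rcases eq_or_ne u 0 with rfl | hu
  · simp
  · by_contra h1
    have := h.2 u u
    rw [integral_undef h1] at this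
    exact hu (inner_self_eq_zero.1 this.symm)

lemma integrable_inner_sq (h : IsIsotropic μ) (u : EucSp n) :
    Integrable (fun x => ⟪x, u⟫ ^ 2) μ := by
  simpa [sq] using h.integrable_inner_mul_self u

lemma integral_inner_sq (h : IsIsotropic μ) (u : EucSp n) :
    ∫ x, ⟪x, u⟫ ^ 2 ∂μ = ‖u‖ ^ 2 := by
  simpa [sq] using h.2 u u

lemma norm_sq_eq (x : EucSp n) :
    ‖x‖ ^ 2 = ∑ i, ⟪x, EuclideanSpace.basisFun (Fin n) ℝ i⟫ ^ 2 := by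
  rw [← (EuclideanSpace.basisFun (Fin n) ℝ).sum_sq_norm_inner_left x]
  simp

lemma integrable_norm_sq (h : IsIsotropic μ) : Integrable (fun x => ‖x‖ ^ 2) μ := by
  simp_rw [norm_sq_eq]
  exact integrable_finsetSum _ fun i _ => h.integrable_inner_sq _

lemma integral_norm_sq (h : IsIsotropic μ) : ∫ x, ‖x‖ ^ 2 ∂μ = n := by
  simp_rw [norm_sq_eq]
  rw [integral_finsetSum _ fun i _ => h.integrable_inner_sq _]
  simp [h.integral_inner_sq]

variable [IsProbabilityMeasure μ]

lemma integrable_norm (h : IsIsotropic μ) : Integrable (fun x => ‖x‖) μ := by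
  refine ((integrable_const (1:ℝ)).add h.integrable_norm_sq).mono' (by fun_prop) ?_
  filter_upwards with x
  rw [norm_norm, Pi.add_apply]
  nlinarith [sq_nonneg (‖x‖ - 1), norm_nonneg x]

lemma integrable_inner (h : IsIsotropic μ) (u : EucSp n) : Integrable (fun x => ⟪x, u⟫) μ := by
  refine (h.integrable_norm.mul_const ‖u‖).mono' (by fun_prop) ?_
  filter_upwards with x
  exact norm_inner_le_norm x u

lemma integral_inner (h : IsIsotropic μ) (u : EucSp n) : ∫ x, ⟪x, u⟫ ∂μ = 0 := by
  have hi : Integrable (fun x : EucSp n => x) μ :=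
    (integrable_norm_iff (by fun_prop)).1 h.integrable_norm
  have := _root_.integral_inner (𝕜 := ℝ) hi u
  simp_rw [real_inner_comm u] at this ⊢
  rw [this, h.1]; simp

lemma integrable_thinShell (h : IsIsotropic μ) :
    Integrable (fun x => (‖x‖ - √n) ^ 2) μ := by
  have : (fun x : EucSp n => (‖x‖ - √n) ^ 2) = fun x => ‖x‖ ^ 2 - (2 * √n) * ‖x‖ + √n ^ 2 := by
    ext x; ring
  rw [this]
  exact (h.integrable_norm_sq.sub (h.integrable_norm.const_mul _)).add (integrable_const _)

lemma integral_thinShell (h : IsIsotropic μ) :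
    ∫ x, (‖x‖ - √n) ^ 2 ∂μ = 2 * n - 2 * √n * ∫ x, ‖x‖ ∂μ := by
  have : (fun x : EucSp n => (‖x‖ - √n) ^ 2) = fun x => ‖x‖ ^ 2 - (2 * √n) * ‖x‖ + n := by
    ext x; rw [sub_sq, Real.sq_sqrt (by positivity)]; ring
  have hi : Integrable (fun x : EucSp n => ‖x‖ ^ 2 - (2 * √n) * ‖x‖) μ :=
    h.integrable_norm_sq.sub (h.integrable_norm.const_mul _)
  rw [this, integral_add hi (integrable_const _), integral_sub h.integrable_norm_sq (h.integrable_norm.const_mul _),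
    integral_const_mul, h.integral_norm_sq]
  simp
  ring

lemma integral_thinShell_le (h : IsIsotropic μ) :
    ∫ x, (‖x‖ - √n) ^ 2 ∂μ ≤ 2 * n := by
  rw [h.integral_thinShell]
  have : 0 ≤ ∫ x, ‖x‖ ∂μ := integral_nonneg fun x => norm_nonneg x
  nlinarith [Real.sqrt_nonneg n, mul_nonneg (Real.sqrt_nonneg n) this]

lemma integral_thinShell_le_sigmaNSq (h : IsIsotropic μ) (hl : IsLogConcave μ) :
    ∫ x, (‖x‖ - √n) ^ 2 ∂μ ≤ sigmaNSq n := by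
  refine le_csSup ⟨2 * n, ?_⟩ ⟨μ, inferInstance, h, hl, rfl⟩
  rintro _ ⟨ν, hν, h1, -, rfl⟩
  exact h1.integral_thinShell_le

end IsIsotropic

lemma sigmaNSq_nonneg (n : ℕ) : 0 ≤ sigmaNSq n := by
  refine Real.sSup_nonneg ?_
  rintro _ ⟨ν, hν, h1, -, rfl⟩
  exact integral_nonneg fun x => sq_nonneg _

lemma sigmaN_sq (n : ℕ) : sigmaN n ^ 2 = sigmaNSq n := Real.sq_sqrt (sigmaNSq_nonneg n)

lemma sigmaN_nonneg (n : ℕ) : 0 ≤ sigmaN n := Real.sqrt_nonneg _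

namespace IsIsotropic

variable {n : ℕ} {μ : Measure (EucSp n)} [IsProbabilityMeasure μ] {f : EucSp n → ℝ}

lemma measure_norm_le (h : IsIsotropic μ) (hn : 1 ≤ n) {R : ℝ} (hR : 0 < R) :
    ENNReal.ofReal (1 - 1 / R ^ 2) ≤ μ {x | ‖x‖ ≤ R * √n} := by
  have hn' : (0:ℝ) < n := by exact_mod_cast hn
  have hmeas : MeasurableSet {x : EucSp n | ‖x‖ ≤ R * √n} := measurableSet_le (by fun_prop) (by fun_prop)
  have hpos : 0 < R ^ 2 * n := by positivity
  have h1 := mul_meas_ge_le_integral_of_nonneg (μ := μ) (f := fun x : EucSp n => ‖x‖ ^ 2)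
    (Eventually.of_forall fun x => sq_nonneg _) h.integrable_norm_sq (R ^ 2 * n)
  rw [h.integral_norm_sq] at h1
  have h2 : μ.real {x : EucSp n | ‖x‖ ≤ R * √n}ᶜ ≤ 1 / R ^ 2 := by
    have : μ.real {x : EucSp n | ‖x‖ ≤ R * √n}ᶜ ≤ μ.real {x | R ^ 2 * n ≤ ‖x‖ ^ 2} := by
      refine measureReal_mono fun x hx => ?_
      have hx : R * √n < ‖x‖ := not_le.1 hx
      have := pow_le_pow_left₀ (by positivity) hx.le 2
      rwa [mul_pow, Real.sq_sqrt hn'.le] at this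
    refine this.trans ?_
    rw [le_div_iff₀ (by positivity)]
    have h3 : R ^ 2 * n * μ.real {x | R ^ 2 * n ≤ ‖x‖ ^ 2} ≤ 1 * n := by simpa using h1
    nlinarith
  rw [probReal_compl_eq_one_sub hmeas] at h2
  rw [ENNReal.ofReal_le_iff_le_toReal (measure_ne_top _ _)]
  change _ ≤ μ.real _
  linarith

lemma lintegral_norm_four_tail (h : IsIsotropic μ) (hn : 1 ≤ n) (hf : IsLogConcaveFn f)
    (hμ : μ = volume.withDensity fun x => ENNReal.ofReal (f x)) :
    (∫⁻ x, {x | 5 * √n ≤ ‖x‖}.indicator (fun x => ENNReal.ofReal (‖x‖ ^ 4)) x ∂μ) *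
      ENNReal.ofReal (3 / 4) ≤
    ENNReal.ofReal (10000 * (∫ x, (‖x‖ - √n) ^ 2 ∂μ) ^ 2) := by
  have hv : MeasurableSet {x : EucSp n | ‖x‖ ≤ 2 * √n} :=
    measurableSet_le (by fun_prop) (by fun_prop)
  have hu : MeasurableSet {x : EucSp n | 5 * √n ≤ ‖x‖} :=
    measurableSet_le (by fun_prop) (by fun_prop)
  have key := hf.prekopaLeindler_withDensity
    (u := {x | 5 * √n ≤ ‖x‖}.indicator (fun x => ENNReal.ofReal (‖x‖ ^ 4)))
    (v := {x | ‖x‖ ≤ 2 * √n}.indicator 1)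
    (w := fun x => ENNReal.ofReal (100 * (‖x‖ - √n) ^ 2))
    (by measurability) (by measurability) (by fun_prop) ?_
  · rw [← hμ, lintegral_indicator_one hv] at key
    have hw : ∫⁻ x, ENNReal.ofReal (100 * (‖x‖ - √n) ^ 2) ∂μ =
        ENNReal.ofReal (100 * ∫ x, (‖x‖ - √n) ^ 2 ∂μ) := by
      rw [← integral_const_mul, ofReal_integral_eq_lintegral_ofReal
        (h.integrable_thinShell.const_mul _)
        (Eventually.of_forall fun x => by simp only [Pi.zero_apply]; positivity)]
    have hm := h.measure_norm_le hn (R := 2) (by norm_num)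
    rw [hw, ← ENNReal.ofReal_pow (mul_nonneg (by norm_num)
      (integral_nonneg fun x => sq_nonneg _)), mul_pow] at key
    norm_num at hm key ⊢
    exact le_trans (by gcongr) key
  · intro x y
    by_cases hx : 5 * √n ≤ ‖x‖
    swap
    · simp [hx]
    by_cases hy : ‖y‖ ≤ 2 * √n
    swap
    · simp [hy]
    rw [indicator_of_mem (by exact hx), indicator_of_mem (by exact hy), Pi.one_apply, mul_one,
      ← ENNReal.ofReal_pow (by positivity)]
    refine ENNReal.ofReal_le_ofReal ?_
    have h1 : ‖x‖ / 10 ≤ ‖(2:ℝ)⁻¹ • (x + y)‖ - √n := by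
      rw [norm_smul]
      have := norm_sub_le (x + y) y
      rw [add_sub_cancel_right] at this
      norm_num
      linarith
    have h2 : (‖x‖ / 10) ^ 4 ≤ (‖(2:ℝ)⁻¹ • (x + y)‖ - √n) ^ 4 := by gcongr
    nlinarith

lemma lintegral_thinShell_four (h : IsIsotropic μ) (hn : 1 ≤ n) (hf : IsLogConcaveFn f)
    (hμ : μ = volume.withDensity fun x => ENNReal.ofReal (f x)) :
    ∫⁻ x, ENNReal.ofReal ((‖x‖ - √n) ^ 4) ∂μ ≤ ENNReal.ofReal (30000 * n * sigmaN n ^ 2) := by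
  have hn' : (0:ℝ) < n := by exact_mod_cast hn
  have hu : MeasurableSet {x : EucSp n | 5 * √n ≤ ‖x‖} :=
    measurableSet_le (by fun_prop) (by fun_prop)
  set S := ∫ x, (‖x‖ - √n) ^ 2 ∂μ with hS
  have hS0 : 0 ≤ S := integral_nonneg fun x => sq_nonneg _
  have hS1 : S ≤ sigmaN n ^ 2 := by
    rw [sigmaN_sq]; exact h.integral_thinShell_le_sigmaNSq ⟨f, hf, hμ⟩
  have hS2 : S ≤ 2 * n := h.integral_thinShell_le
  have h1 := h.lintegral_norm_four_tail hn hf hμ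
  rw [← hS] at h1
  set U := ∫⁻ x, {x | 5 * √n ≤ ‖x‖}.indicator (fun x => ENNReal.ofReal (‖x‖ ^ 4)) x ∂μ with hU
  have hU1 : U ≤ ENNReal.ofReal (40000 / 3 * S ^ 2) := by
    have : U = U * ENNReal.ofReal (3 / 4) * ENNReal.ofReal (4 / 3) := by
      rw [mul_assoc, ← ENNReal.ofReal_mul (by norm_num)]; norm_num
    rw [this]
    calc _ ≤ ENNReal.ofReal (10000 * S ^ 2) * ENNReal.ofReal (4 / 3) := by gcongr
      _ = _ := by rw [← ENNReal.ofReal_mul (by positivity)]; ring_nf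
  calc ∫⁻ x, ENNReal.ofReal ((‖x‖ - √n) ^ 4) ∂μ
      ≤ ∫⁻ x, (ENNReal.ofReal (16 * n * (‖x‖ - √n) ^ 2) +
        {x | 5 * √n ≤ ‖x‖}.indicator (fun x => ENNReal.ofReal (‖x‖ ^ 4)) x) ∂μ := by
        refine lintegral_mono fun x => ?_
        have hs := Real.sq_sqrt hn'.le
        have hs0 := Real.sqrt_nonneg n
        by_cases hx : 5 * √n ≤ ‖x‖
        · rw [indicator_of_mem (by exact hx)]
          refine le_trans ?_ le_add_self
          refine ENNReal.ofReal_le_ofReal ?_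
          have : 0 ≤ ‖x‖ - √n := by linarith
          gcongr; linarith
        · rw [indicator_of_notMem (by exact hx), add_zero]
          refine ENNReal.ofReal_le_ofReal ?_
          have hx := not_le.1 hx
          have h3 : (‖x‖ - √n) ^ 2 ≤ 16 * √n ^ 2 := by nlinarith [norm_nonneg x]
          rw [hs] at h3
          nlinarith [sq_nonneg (‖x‖ - √n)]
    _ = ENNReal.ofReal (16 * n * S) + U := by
        rw [lintegral_add_left (by fun_prop), hS, ← integral_const_mul,
          ofReal_integral_eq_lintegral_ofReal (h.integrable_thinShell.const_mul _)
          (Eventually.of_forall fun x => by simp only [Pi.zero_apply]; positivity)]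
    _ ≤ ENNReal.ofReal (16 * n * S) + ENNReal.ofReal (40000 / 3 * S ^ 2) := by gcongr
    _ = ENNReal.ofReal (16 * n * S + 40000 / 3 * S ^ 2) := by
        rw [ENNReal.ofReal_add (by positivity) (by positivity)]
    _ ≤ _ := by
        refine ENNReal.ofReal_le_ofReal ?_
        nlinarith [mul_le_mul hS1 hS2 hS0 (sq_nonneg _), mul_le_mul_of_nonneg_left hS1 hn'.le]

lemma integrable_thinShell_four (h : IsIsotropic μ) (hn : 1 ≤ n) (hf : IsLogConcaveFn f)
    (hμ : μ = volume.withDensity fun x => ENNReal.ofReal (f x)) :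
    Integrable (fun x => (‖x‖ - √n) ^ 4) μ := by
  refine ⟨by fun_prop, ?_⟩
  rw [hasFiniteIntegral_iff_ofReal (Eventually.of_forall fun x => by
    simp only [Pi.zero_apply]; positivity)]
  exact (h.lintegral_thinShell_four hn hf hμ).trans_lt ENNReal.ofReal_lt_top

lemma integral_thinShell_four_le (h : IsIsotropic μ) (hn : 1 ≤ n) (hf : IsLogConcaveFn f)
    (hμ : μ = volume.withDensity fun x => ENNReal.ofReal (f x)) :
    ∫ x, (‖x‖ - √n) ^ 4 ∂μ ≤ 30000 * n * sigmaN n ^ 2 := by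
  rw [← ENNReal.ofReal_le_ofReal_iff (by positivity), ofReal_integral_eq_lintegral_ofReal
    (h.integrable_thinShell_four hn hf hμ) (Eventually.of_forall fun x => by
      simp only [Pi.zero_apply]; positivity)]
  exact h.lintegral_thinShell_four hn hf hμ

lemma integrable_norm_four (h : IsIsotropic μ) (hn : 1 ≤ n) (hf : IsLogConcaveFn f)
    (hμ : μ = volume.withDensity fun x => ENNReal.ofReal (f x)) :
    Integrable (fun x => ‖x‖ ^ 4) μ := by
  refine (((h.integrable_thinShell_four hn hf hμ).const_mul 8).add
    (integrable_const (8 * (n:ℝ) ^ 2))).mono' (by fun_prop) (Eventually.of_forall fun x => ?_)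
  rw [Real.norm_of_nonneg (by positivity), Pi.add_apply]
  have hs := Real.sq_sqrt (Nat.cast_nonneg (α := ℝ) n)
  have hs2 : (n:ℝ) ^ 2 = √n ^ 4 := by rw [show √(n:ℝ) ^ 4 = (√n ^ 2) ^ 2 by ring, hs]
  rw [hs2]
  have : ‖x‖ ^ 2 ≤ 2 * ((‖x‖ - √n) ^ 2 + √n ^ 2) := by nlinarith [sq_nonneg (‖x‖ - 2 * √n)]
  have h2 := pow_le_pow_left₀ (by positivity) this 2
  nlinarith [sq_nonneg ((‖x‖ - √n) ^ 2 - √n ^ 2)]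

/-- The third moments of an isotropic log-concave measure are controlled by the thin-shell
constant. -/
lemma abs_integral_norm_sq_mul_inner_le (h : IsIsotropic μ) (hn : 1 ≤ n) (hf : IsLogConcaveFn f)
    (hμ : μ = volume.withDensity fun x => ENNReal.ofReal (f x)) (u : EucSp n) {a : ℝ}
    (ha : 0 < a) :
    |∫ x, ‖x‖ ^ 2 * ⟪x, u⟫ ∂μ| ≤ (a * (62500 * n * sigmaN n ^ 2) + ‖u‖ ^ 2 / a) / 2 := by
  have hn' : (0:ℝ) < n := by exact_mod_cast hn
  have hs := Real.sq_sqrt hn'.le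
  have i4 := h.integrable_norm_four hn hf hμ
  have i1 : Integrable (fun x => (‖x‖ ^ 2 - n) ^ 2) μ := by
    have : (fun x : EucSp n => (‖x‖ ^ 2 - n) ^ 2) =
      fun x => ‖x‖ ^ 4 - (2 * n) * ‖x‖ ^ 2 + (n:ℝ) ^ 2 := by ext x; ring
    rw [this]
    exact (i4.sub (h.integrable_norm_sq.const_mul _)).add (integrable_const _)
  have hb : ∫ x, (‖x‖ ^ 2 - n) ^ 2 ∂μ ≤ 62500 * n * sigmaN n ^ 2 := by
    have e : ∀ x : EucSp n, (‖x‖ ^ 2 - n) ^ 2 ≤ 2 * (‖x‖ - √n) ^ 4 + 8 * n * (‖x‖ - √n) ^ 2 := by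
      intro x
      have : (‖x‖ ^ 2 - n) ^ 2 = (‖x‖ - √n) ^ 2 * ((‖x‖ - √n) + 2 * √n) ^ 2 := by
        nth_rw 1 [← hs]; ring
      rw [this]
      nth_rw 5 [← hs]
      nlinarith [mul_nonneg (sq_nonneg (‖x‖ - √n)) (sq_nonneg (‖x‖ - √n - 2 * √n))]
    have j4 := (h.integrable_thinShell_four hn hf hμ).const_mul 2
    have j2 := h.integrable_thinShell.const_mul (8 * n : ℝ)
    refine (integral_mono i1 (j4.add j2) e).trans ?_
    rw [integral_add' j4 j2, integral_const_mul, integral_const_mul]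
    have h4 := h.integral_thinShell_four_le hn hf hμ
    have h2 := h.integral_thinShell_le_sigmaNSq ⟨f, hf, hμ⟩
    rw [← sigmaN_sq] at h2
    nlinarith [mul_le_mul_of_nonneg_left h2 hn'.le, mul_nonneg hn'.le (sq_nonneg (sigmaN n))]
  have i3 : Integrable (fun x => ‖x‖ ^ 2 * ⟪x, u⟫) μ := by
    refine ((i4.add (integrable_const 1)).mul_const ‖u‖).mono' (by fun_prop)
      (Eventually.of_forall fun x => ?_)
    rw [norm_mul, norm_pow, norm_norm, Pi.add_apply]
    calc ‖x‖ ^ 2 * ‖⟪x, u⟫‖ ≤ ‖x‖ ^ 2 * (‖x‖ * ‖u‖) := by gcongr; exact norm_inner_le_norm x u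
      _ = ‖x‖ ^ 3 * ‖u‖ := by ring
      _ ≤ _ := by
        gcongr
        nlinarith [sq_nonneg (‖x‖ ^ 2 - ‖x‖), sq_nonneg (‖x‖ - 1), sq_nonneg (‖x‖ ^ 2 - 1)]
  have hsq := h.integrable_inner_sq u
  have e1 : ∫ x, ‖x‖ ^ 2 * ⟪x, u⟫ ∂μ = ∫ x, (‖x‖ ^ 2 - n) * ⟪x, u⟫ ∂μ := by
    simp_rw [sub_mul]
    rw [integral_sub i3 ((h.integrable_inner u).const_mul _), integral_const_mul,
      h.integral_inner]
    simp
  rw [e1]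
  calc |∫ x, (‖x‖ ^ 2 - n) * ⟪x, u⟫ ∂μ| ≤ ∫ x, |(‖x‖ ^ 2 - n) * ⟪x, u⟫| ∂μ :=
        abs_integral_le_integral_abs
    _ ≤ ∫ x, (a / 2 * (‖x‖ ^ 2 - n) ^ 2 + 1 / (2 * a) * ⟪x, u⟫ ^ 2) ∂μ := by
        refine integral_mono_of_nonneg (Eventually.of_forall fun x => abs_nonneg _)
          ((i1.const_mul _).add (hsq.const_mul _)) (Eventually.of_forall fun x => ?_)
        simp only
        rw [abs_mul, ← sq_abs (‖x‖ ^ 2 - n), ← sq_abs ⟪x, u⟫]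
        generalize |‖x‖ ^ 2 - n| = p
        generalize |⟪x, u⟫| = q
        have : a / 2 * p ^ 2 + 1 / (2 * a) * q ^ 2 - p * q = (a * p - q) ^ 2 / (2 * a) := by
          field_simp; ring
        have h0 : 0 ≤ (a * p - q) ^ 2 / (2 * a) := by positivity
        linarith
    _ = a / 2 * ∫ x, (‖x‖ ^ 2 - n) ^ 2 ∂μ + 1 / (2 * a) * ‖u‖ ^ 2 := by
        rw [integral_add (i1.const_mul _) (hsq.const_mul _), integral_const_mul,
          integral_const_mul, h.integral_inner_sq]
    _ ≤ a / 2 * (62500 * n * sigmaN n ^ 2) + 1 / (2 * a) * ‖u‖ ^ 2 := by gcongr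
    _ = _ := by field_simp

end IsIsotropic

namespace IsLogConcaveFn

variable {n : ℕ} {f : EucSp n → ℝ}

lemma indicator_mul (hf : IsLogConcaveFn f) {s : Set (EucSp n)} (hs : Convex ℝ s) {c : ℝ}
    (hc : 0 < c) : IsLogConcaveFn (s.indicator fun x => c * f x) := by
  have h0 : ∀ x, 0 ≤ s.indicator (fun x => c * f x) x := fun x =>
    indicator_nonneg (fun y _ => mul_nonneg hc.le (hf.1 y)) x
  refine ⟨h0, fun x y l hl => ?_⟩
  rcases eq_or_ne l 0 with rfl | hl0
  · simp
  rcases eq_or_ne l 1 with rfl | hl1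
  · simp
  by_cases hx : x ∈ s
  swap
  · rw [indicator_of_notMem hx, zero_rpow (sub_ne_zero.2 hl1.symm), zero_mul]; exact h0 _
  by_cases hy : y ∈ s
  swap
  · rw [indicator_of_notMem hy, zero_rpow hl0, mul_zero]; exact h0 _
  have hz : (1 - l) • x + l • y ∈ s := hs hx hy (sub_nonneg.2 hl.2) hl.1 (by ring)
  rw [indicator_of_mem hx, indicator_of_mem hy, indicator_of_mem hz,
    mul_rpow hc.le (hf.1 x), mul_rpow hc.le (hf.1 y)]
  calc c ^ (1 - l) * f x ^ (1 - l) * (c ^ l * f y ^ l)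
      = c ^ (1 - l) * c ^ l * (f x ^ (1 - l) * f y ^ l) := by ring
    _ = c * (f x ^ (1 - l) * f y ^ l) := by rw [← rpow_add hc]; simp
    _ ≤ _ := by gcongr; exact hf.2 x y l hl

end IsLogConcaveFn

/-- A probability measure with a log-concave density supported in a ball around the origin. -/
structure IsCompactLogConcave {n : ℕ} (P : Measure (EucSp n)) (p : EucSp n → ℝ) (ρ : ℝ) :
    Prop where
  logConcave : IsLogConcaveFn p
  eq_withDensity : P = volume.withDensity fun x => ENNReal.ofReal (p x)
  prob : IsProbabilityMeasure P
  norm_le : ∀ x, p x ≠ 0 → ‖x‖ ≤ ρ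

namespace IsIsotropic

variable {n : ℕ} {μ : Measure (EucSp n)} [IsProbabilityMeasure μ] {f : EucSp n → ℝ}

lemma measure_abs_inner_le (h : IsIsotropic μ) {u : EucSp n} (hu : ‖u‖ = 1) :
    ENNReal.ofReal (3 / 4) ≤ μ {x | |⟪x, u⟫| ≤ 2} := by
  have hmeas : MeasurableSet {x : EucSp n | |⟪x, u⟫| ≤ 2} :=
    measurableSet_le (by fun_prop) (by fun_prop)
  have h1 := mul_meas_ge_le_integral_of_nonneg (μ := μ) (f := fun x : EucSp n => ⟪x, u⟫ ^ 2)
    (Eventually.of_forall fun x => sq_nonneg _) (h.integrable_inner_sq u) 4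
  rw [h.integral_inner_sq, hu] at h1
  have h2 : μ.real {x : EucSp n | |⟪x, u⟫| ≤ 2}ᶜ ≤ 1 / 4 := by
    have : μ.real {x : EucSp n | |⟪x, u⟫| ≤ 2}ᶜ ≤ μ.real {x : EucSp n | 4 ≤ ⟪x, u⟫ ^ 2} := by
      refine measureReal_mono fun x hx => ?_
      have hx : 2 < |⟪x, u⟫| := not_le.1 hx
      have := pow_le_pow_left₀ (by positivity) hx.le 2
      rw [sq_abs] at this
      exact le_trans (by norm_num) this
    have h3 : 4 * μ.real {x : EucSp n | 4 ≤ ⟪x, u⟫ ^ 2} ≤ 1 := by simpa using h1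
    linarith
  rw [probReal_compl_eq_one_sub hmeas] at h2
  rw [ENNReal.ofReal_le_iff_le_toReal (measure_ne_top _ _)]
  change _ ≤ μ.real _
  linarith

lemma lintegral_inner_four (h : IsIsotropic μ) (hf : IsLogConcaveFn f)
    (hμ : μ = volume.withDensity fun x => ENNReal.ofReal (f x)) {u : EucSp n} (hu : ‖u‖ = 1) :
    ∫⁻ x, ENNReal.ofReal (⟪x, u⟫ ^ 4) ∂μ ≤ ENNReal.ofReal 342 := by
  have hv : MeasurableSet {x : EucSp n | |⟪x, u⟫| ≤ 2} :=
    measurableSet_le (by fun_prop) (by fun_prop)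
  have key := hf.prekopaLeindler_withDensity
    (u := fun x => ENNReal.ofReal (⟪x, u⟫ ^ 4))
    (v := {x | |⟪x, u⟫| ≤ 2}.indicator 1)
    (w := fun x => ENNReal.ofReal (8 * (⟪x, u⟫ ^ 2 + 1)))
    (by fun_prop) (by measurability) (by fun_prop) ?_
  · rw [← hμ, lintegral_indicator_one hv] at key
    have hw : ∫⁻ x, ENNReal.ofReal (8 * (⟪x, u⟫ ^ 2 + 1)) ∂μ = ENNReal.ofReal 16 := by
      have hi : Integrable (fun x => ⟪x, u⟫ ^ 2 + 1) μ :=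
        (h.integrable_inner_sq u).add (integrable_const _)
      rw [← ofReal_integral_eq_lintegral_ofReal (hi.const_mul _)
        (Eventually.of_forall fun x => by simp only [Pi.zero_apply]; positivity),
        integral_const_mul, integral_add (h.integrable_inner_sq u) (integrable_const _),
        h.integral_inner_sq, hu]
      norm_num
    have hm := h.measure_abs_inner_le hu
    rw [hw] at key
    set U := ∫⁻ x, ENNReal.ofReal (⟪x, u⟫ ^ 4) ∂μ
    have : U = U * ENNReal.ofReal (3 / 4) * ENNReal.ofReal (4 / 3) := by
      rw [mul_assoc, ← ENNReal.ofReal_mul (by norm_num)]; norm_num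
    rw [this]
    calc U * ENNReal.ofReal (3 / 4) * ENNReal.ofReal (4 / 3)
        ≤ ENNReal.ofReal 16 ^ 2 * ENNReal.ofReal (4 / 3) := by
          gcongr; exact le_trans (by gcongr) key
      _ = ENNReal.ofReal (16 ^ 2 * (4 / 3)) := by
          rw [← ENNReal.ofReal_pow (by norm_num), ← ENNReal.ofReal_mul (by norm_num)]
      _ ≤ _ := ENNReal.ofReal_le_ofReal (by norm_num)
  · intro x y
    by_cases hy : |⟪y, u⟫| ≤ 2
    swap
    · simp [hy]
    rw [indicator_of_mem (by exact hy), Pi.one_apply, mul_one, ← ENNReal.ofReal_pow (by positivity)]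
    refine ENNReal.ofReal_le_ofReal ?_
    have e : ⟪x, u⟫ = 2 * ⟪(2:ℝ)⁻¹ • (x + y), u⟫ - ⟪y, u⟫ := by
      rw [inner_smul_left, inner_add_left]; simp
    rw [e]
    generalize ⟪(2:ℝ)⁻¹ • (x + y), u⟫ = z
    generalize ⟪y, u⟫ = t at hy
    have hy2 : t ^ 2 ≤ 4 := by rw [← sq_abs]; nlinarith [abs_nonneg t]
    have h1 : (2 * z - t) ^ 2 ≤ 8 * (z ^ 2 + 1) := by nlinarith [sq_nonneg (2 * z + t)]
    have := pow_le_pow_left₀ (sq_nonneg _) h1 2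
    calc _ = ((2 * z - t) ^ 2) ^ 2 := by ring
      _ ≤ _ := this

lemma integrable_inner_four (h : IsIsotropic μ) (hf : IsLogConcaveFn f)
    (hμ : μ = volume.withDensity fun x => ENNReal.ofReal (f x)) {u : EucSp n} (hu : ‖u‖ = 1) :
    Integrable (fun x => ⟪x, u⟫ ^ 4) μ := by
  refine ⟨by fun_prop, ?_⟩
  rw [hasFiniteIntegral_iff_ofReal (Eventually.of_forall fun x => by
    simp only [Pi.zero_apply]; positivity)]
  exact (h.lintegral_inner_four hf hμ hu).trans_lt ENNReal.ofReal_lt_top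

lemma integral_inner_four_le (h : IsIsotropic μ) (hf : IsLogConcaveFn f)
    (hμ : μ = volume.withDensity fun x => ENNReal.ofReal (f x)) {u : EucSp n} (hu : ‖u‖ = 1) :
    ∫ x, ⟪x, u⟫ ^ 4 ∂μ ≤ 342 := by
  rw [← ENNReal.ofReal_le_ofReal_iff (by positivity), ofReal_integral_eq_lintegral_ofReal
    (h.integrable_inner_four hf hμ hu) (Eventually.of_forall fun x => by
      simp only [Pi.zero_apply]; positivity)]
  exact h.lintegral_inner_four hf hμ hu

lemma setIntegral_inner_sq_compl_le (h : IsIsotropic μ) (hn : 1 ≤ n) (hf : IsLogConcaveFn f)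
    (hμ : μ = volume.withDensity fun x => ENNReal.ofReal (f x)) {u : EucSp n} (hu : ‖u‖ = 1) :
    ∫ x in {x | ‖x‖ ≤ 100 * √n}ᶜ, ⟪x, u⟫ ^ 2 ∂μ ≤ 1 / 4 := by
  have hmeas : MeasurableSet {x : EucSp n | ‖x‖ ≤ 100 * √n} :=
    measurableSet_le (by fun_prop) (by fun_prop)
  have hm := h.measure_norm_le hn (R := 100) (by norm_num)
  rw [ENNReal.ofReal_le_iff_le_toReal (measure_ne_top _ _)] at hm
  change _ ≤ μ.real _ at hm
  have hc := probReal_compl_eq_one_sub (μ := μ) hmeas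
  have i4 := h.integrable_inner_four hf hμ hu
  have j4 : IntegrableOn (fun x => 1 / 2000 * ⟪x, u⟫ ^ 4) {x | ‖x‖ ≤ 100 * √n}ᶜ μ :=
    (i4.const_mul _).integrableOn
  have j0 : IntegrableOn (fun _ : EucSp n => (500:ℝ)) {x | ‖x‖ ≤ 100 * √n}ᶜ μ :=
    (integrable_const _).integrableOn
  calc ∫ x in {x | ‖x‖ ≤ 100 * √n}ᶜ, ⟪x, u⟫ ^ 2 ∂μ
      ≤ ∫ x in {x | ‖x‖ ≤ 100 * √n}ᶜ, (1 / 2000 * ⟪x, u⟫ ^ 4 + 500) ∂μ := by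
        refine integral_mono (h.integrable_inner_sq u).integrableOn (j4.add j0) fun x => ?_
        simp only
        nlinarith [sq_nonneg (⟪x, u⟫ ^ 2 - 1000)]
    _ = (∫ x in {x | ‖x‖ ≤ 100 * √n}ᶜ, 1 / 2000 * ⟪x, u⟫ ^ 4 ∂μ) +
        500 * μ.real {x : EucSp n | ‖x‖ ≤ 100 * √n}ᶜ := by
        rw [integral_add j4 j0, setIntegral_const, smul_eq_mul, mul_comm (500:ℝ)]
    _ ≤ (∫ x, 1 / 2000 * ⟪x, u⟫ ^ 4 ∂μ) + 500 * μ.real {x : EucSp n | ‖x‖ ≤ 100 * √n}ᶜ := by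
        refine add_le_add (setIntegral_le_integral (i4.const_mul _)
          (Eventually.of_forall fun x => ?_)) le_rfl
        change (0:ℝ) ≤ 1 / 2000 * ⟪x, u⟫ ^ 4; positivity
    _ ≤ 1 / 4 := by
        rw [integral_const_mul]
        have := h.integral_inner_four_le hf hμ hu
        norm_num at hm
        linarith

/-- An isotropic log-concave measure may be truncated to a ball of radius proportional to `√n`
without losing more than half of the variance in any direction. -/
lemma exists_truncation (h : IsIsotropic μ) (hn : 1 ≤ n) (hf : IsLogConcaveFn f)
    (hμ : μ = volume.withDensity fun x => ENNReal.ofReal (f x)) :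
    ∃ (P : Measure (EucSp n)) (p : EucSp n → ℝ), IsCompactLogConcave P p (100 * √n) ∧
      f 0 ≤ p 0 ∧ ‖∫ x, x ∂P‖ ≤ 1 ∧
      ∀ u, ‖u‖ ^ 2 / 2 ≤ ∫ x, ⟪x - ∫ y, y ∂P, u⟫ ^ 2 ∂P := by
  set B : Set (EucSp n) := {x | ‖x‖ ≤ 100 * √n} with hB
  have hmeas : MeasurableSet B := measurableSet_le (by fun_prop) (by fun_prop)
  have hconv : Convex ℝ B := by
    have : B = Metric.closedBall 0 (100 * √n) := by ext; simp [hB]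
    rw [this]; exact convex_closedBall _ _
  have hm := h.measure_norm_le hn (R := 100) (by norm_num)
  rw [ENNReal.ofReal_le_iff_le_toReal (measure_ne_top _ _)] at hm
  change _ ≤ μ.real B at hm
  set m := μ.real B with hmdef
  have hm1 : m ≤ 1 := measureReal_le_one
  norm_num at hm
  have hm0 : 0 < m := by linarith
  set p : EucSp n → ℝ := B.indicator fun x => m⁻¹ * f x with hp
  set P : Measure (EucSp n) := volume.withDensity fun x => ENNReal.ofReal (p x) with hP
  have hPμ : P = ENNReal.ofReal m⁻¹ • μ.restrict B := by
    have : (fun x => ENNReal.ofReal (p x)) =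
        B.indicator (ENNReal.ofReal m⁻¹ • fun x => ENNReal.ofReal (f x)) := by
      ext x
      by_cases hx : x ∈ B
      · simp [hp, hx, ENNReal.ofReal_mul (inv_nonneg.2 hm0.le)]
      · simp [hp, hx]
    rw [hP, this, withDensity_indicator hmeas, withDensity_smul' _ _ ENNReal.ofReal_ne_top,
      hμ, restrict_withDensity hmeas]
  have hprob : IsProbabilityMeasure P := ⟨by
    rw [hPμ, Measure.smul_apply, Measure.restrict_apply_univ, ← ofReal_measureReal, ← hmdef,
      smul_eq_mul, ← ENNReal.ofReal_mul (inv_nonneg.2 hm0.le), inv_mul_cancel₀ hm0.ne']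
    simp⟩
  have hI : ∀ g : EucSp n → ℝ, ∫ x, g x ∂P = m⁻¹ * ∫ x in B, g x ∂μ := by
    intro g
    rw [hPμ, integral_smul_measure, ENNReal.toReal_ofReal (inv_nonneg.2 hm0.le), smul_eq_mul]
  have h_int : ∀ g : EucSp n → ℝ, Integrable g μ → Integrable g P := by
    intro g hg
    rw [hPμ]
    exact hg.integrableOn.smul_measure ENNReal.ofReal_ne_top
  have hid : Integrable (fun x : EucSp n => x) P :=
    (integrable_norm_iff (by fun_prop)).1 (h_int _ h.integrable_norm)
  set b := ∫ x, x ∂P with hb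
  have hbu : ∀ u : EucSp n, ∫ x, ⟪x, u⟫ ∂P = ⟪b, u⟫ := by
    intro u
    have := _root_.integral_inner (𝕜 := ℝ) hid u
    simp_rw [real_inner_comm u] at this ⊢
    exact this
  have hbu1 : ∀ u : EucSp n, ‖u‖ = 1 → |⟪b, u⟫| ≤ 1 / 2 := by
    intro u hu
    have hi := h.integrable_inner u
    have h1 : ∫ x in B, ⟪x, u⟫ ∂μ = -∫ x in Bᶜ, ⟪x, u⟫ ∂μ := by
      have := integral_add_compl hmeas hi
      rw [h.integral_inner] at this
      linarith
    have h2 : |∫ x in Bᶜ, ⟪x, u⟫ ∂μ| ≤ ∫ x in Bᶜ, (1 / 2 * ⟪x, u⟫ ^ 2 + 1 / 2) ∂μ := by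
      refine abs_integral_le_integral_abs.trans (integral_mono hi.abs.integrableOn
        (((h.integrable_inner_sq u).const_mul _).add (integrable_const _)).integrableOn
        fun x => ?_)
      simp only
      nlinarith [sq_nonneg (|⟪x, u⟫| - 1), sq_abs ⟪x, u⟫]
    rw [integral_add ((h.integrable_inner_sq u).const_mul _).integrableOn
      (integrable_const _), integral_const_mul, setIntegral_const,
      probReal_compl_eq_one_sub hmeas, smul_eq_mul] at h2
    have h3 := h.setIntegral_inner_sq_compl_le hn hf hμ hu
    rw [← hB] at h3
    rw [← hbu, hI, h1, abs_mul, abs_neg, abs_of_pos (inv_pos.2 hm0)]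
    have h4 : |∫ x in Bᶜ, ⟪x, u⟫ ∂μ| ≤ 1 / 4 := by linarith
    rw [inv_mul_le_iff₀ hm0]
    linarith
  refine ⟨P, p, ⟨hf.indicator_mul hconv (inv_pos.2 hm0), hP, hprob, fun x hx => ?_⟩, ?_, ?_, ?_⟩
  · by_contra hxB
    exact hx (indicator_of_notMem (s := B) (a := x) hxB _)
  · have : (0 : EucSp n) ∈ B := by simp only [hB, mem_ofPred_eq, norm_zero]; positivity
    rw [hp, indicator_of_mem this]
    exact le_mul_of_one_le_left (hf.1 0) ((one_le_inv₀ hm0).2 hm1)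
  · rcases eq_or_ne b 0 with h0 | h0
    · change ‖b‖ ≤ 1
      simp [h0]
    change ‖b‖ ≤ 1
    have := hbu1 (‖b‖⁻¹ • b) (norm_smul_inv_norm (𝕜 := ℝ) h0)
    rw [inner_smul_right, real_inner_self_eq_norm_sq, sq, inv_mul_cancel_left₀
      (norm_ne_zero_iff.2 h0), abs_norm] at this
    linarith
  · have main : ∀ u : EucSp n, ‖u‖ = 1 → 1 / 2 ≤ ∫ x, ⟪x - b, u⟫ ^ 2 ∂P := by
      intro u hu
      have e : ∀ x : EucSp n, ⟪x - b, u⟫ ^ 2 = ⟪x, u⟫ ^ 2 - 2 * ⟪b, u⟫ * ⟪x, u⟫ + ⟪b, u⟫ ^ 2 := by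
        intro x; rw [inner_sub_left]; ring
      have i1 := h_int _ (h.integrable_inner u)
      have i2 := h_int _ (h.integrable_inner_sq u)
      have i3 : Integrable (fun x => ⟪x, u⟫ ^ 2 - 2 * ⟪b, u⟫ * ⟪x, u⟫) P :=
        i2.sub (i1.const_mul _)
      simp_rw [e]
      rw [integral_add i3 (integrable_const _), integral_sub i2 (i1.const_mul _),
        integral_const_mul, hbu, hI (fun x => ⟪x, u⟫ ^ 2)]
      have h1 := integral_add_compl hmeas (h.integrable_inner_sq u)
      rw [h.integral_inner_sq, hu] at h1
      have h3 := h.setIntegral_inner_sq_compl_le hn hf hμ hu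
      rw [← hB] at h3
      have h4 : 3 / 4 ≤ ∫ x in B, ⟪x, u⟫ ^ 2 ∂μ := by linarith
      have h5 : 3 / 4 ≤ m⁻¹ * ∫ x in B, ⟪x, u⟫ ^ 2 ∂μ := by
        rw [le_inv_mul_iff₀ hm0]; nlinarith
      have h6 : ⟪b, u⟫ ^ 2 ≤ 1 / 4 := by
        rw [← sq_abs]; nlinarith [hbu1 u hu, abs_nonneg ⟪b, u⟫]
      simp only [integral_const, probReal_univ, smul_eq_mul, one_mul]
      nlinarith
    intro u
    rcases eq_or_ne u 0 with rfl | h0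
    · simp
    have := main (‖u‖⁻¹ • u) (norm_smul_inv_norm (𝕜 := ℝ) h0)
    simp_rw [inner_smul_right, mul_pow] at this
    rw [integral_const_mul, inv_pow, le_inv_mul_iff₀ (by positivity)] at this
    linarith

end IsIsotropic

/-- The exponential tilt of a measure by the linear functional `⟪ξ, ·⟫`. -/
noncomputable def expTilt {n : ℕ} (P : Measure (EucSp n)) (ξ : EucSp n) : Measure (EucSp n) :=
  P.tilted fun x => ⟪ξ, x⟫

/-- The Laplace transform of a measure. -/
noncomputable def laplace {n : ℕ} (P : Measure (EucSp n)) (ξ : EucSp n) : ℝ := ∫ x, rexp ⟪ξ, x⟫ ∂P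

/-- The barycenter of a measure. -/
noncomputable def bary {n : ℕ} (P : Measure (EucSp n)) : EucSp n := ∫ x, x ∂P

lemma integral_expTilt {n : ℕ} {F : Type*} [NormedAddCommGroup F] [NormedSpace ℝ F]
    (P : Measure (EucSp n)) (ξ : EucSp n) (g : EucSp n → F) :
    ∫ x, g x ∂(expTilt P ξ) = (laplace P ξ)⁻¹ • ∫ x, rexp ⟪ξ, x⟫ • g x ∂P := by
  rw [expTilt, integral_tilted, ← integral_smul]
  refine integral_congr_ae (Eventually.of_forall fun x => ?_)
  simp only [smul_smul, laplace, div_eq_inv_mul]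

namespace IsCompactLogConcave

variable {n : ℕ} {P : Measure (EucSp n)} {p : EucSp n → ℝ} {ρ : ℝ}

lemma ae_norm_le (h : IsCompactLogConcave P p ρ) : ∀ᵐ x ∂P, ‖x‖ ≤ ρ := by
  have hm : MeasurableSet {x : EucSp n | ¬ ‖x‖ ≤ ρ} :=
    (measurableSet_le measurable_norm measurable_const).compl
  rw [ae_iff, h.eq_withDensity, withDensity_apply _ hm]
  refine setLIntegral_eq_zero hm fun x hx => ?_
  have : p x = 0 := by
    by_contra h0
    exact hx (h.norm_le x h0)
  simp [this]

lemma exists_bound (h : IsCompactLogConcave P p ρ) {F : Type*} [NormedAddCommGroup F]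
    {g : EucSp n → F} (hg : Continuous g) : ∃ c, 0 ≤ c ∧ ∀ᵐ x ∂P, ‖g x‖ ≤ c := by
  obtain ⟨c, hc⟩ := (isCompact_closedBall (0 : EucSp n) ρ).exists_bound_of_continuousOn
    hg.continuousOn
  refine ⟨max c 0, le_max_right _ _, ?_⟩
  filter_upwards [h.ae_norm_le] with x hx
  exact (hc x (by simpa using hx)).trans (le_max_left _ _)

lemma integrable (h : IsCompactLogConcave P p ρ) {F : Type*} [NormedAddCommGroup F]
    {g : EucSp n → F} (hg : Continuous g) : Integrable g P := by
  have := h.prob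
  obtain ⟨c, -, hc⟩ := h.exists_bound hg
  exact (integrable_const c).mono' hg.aestronglyMeasurable hc

lemma inner_bary (h : IsCompactLogConcave P p ρ) (u : EucSp n) :
    ∫ x, ⟪x, u⟫ ∂P = ⟪bary P, u⟫ := by
  have := _root_.integral_inner (𝕜 := ℝ) (h.integrable (g := fun x => x) continuous_id) u
  simp_rw [real_inner_comm u] at this ⊢
  exact this

lemma laplace_pos (h : IsCompactLogConcave P p ρ) (ξ : EucSp n) : 0 < laplace P ξ := by
  have := h.prob
  exact integral_exp_pos (h.integrable (by fun_prop))

lemma expTilt (h : IsCompactLogConcave P p ρ) (ξ : EucSp n) :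
    IsCompactLogConcave (expTilt P ξ) (fun x => rexp ⟪ξ, x⟫ / laplace P ξ * p x) ρ := by
  have := h.prob
  have hZ := h.laplace_pos ξ
  refine ⟨⟨fun x => mul_nonneg (by positivity) (h.logConcave.1 x), fun x y l hl => ?_⟩, ?_,
    isProbabilityMeasure_tilted (h.integrable (by fun_prop)), fun x hx => ?_⟩
  · have key : ∀ z, rexp ⟪ξ, z⟫ / laplace P ξ = rexp (⟪ξ, z⟫ - log (laplace P ξ)) := by
      intro z; rw [exp_sub, exp_log hZ]
    simp only [key]
    rw [mul_rpow (exp_pos _).le (h.logConcave.1 x), mul_rpow (exp_pos _).le (h.logConcave.1 y),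
      mul_mul_mul_comm, ← exp_mul, ← exp_mul, ← exp_add]
    have e : (⟪ξ, x⟫ - log (laplace P ξ)) * (1 - l) + (⟪ξ, y⟫ - log (laplace P ξ)) * l =
        ⟪ξ, (1 - l) • x + l • y⟫ - log (laplace P ξ) := by
      rw [inner_add_right, inner_smul_right, inner_smul_right]; ring
    rw [e]
    gcongr
    exact h.logConcave.2 x y l hl
  · rw [_root_.expTilt, Measure.tilted]
    conv_lhs => rw [h.eq_withDensity]
    rw [← withDensity_mul₀ h.logConcave.aemeasurable.ennreal_ofReal (by fun_prop)]
    congr 1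
    ext x
    rw [Pi.mul_apply, mul_comm, ← ENNReal.ofReal_mul (by positivity), ← h.eq_withDensity]
    rfl
  · exact h.norm_le x (right_ne_zero_of_mul hx)

lemma expTilt_expTilt (h : IsCompactLogConcave P p ρ) (ξ η : EucSp n) :
    _root_.expTilt (_root_.expTilt P ξ) η = _root_.expTilt P (ξ + η) := by
  rw [_root_.expTilt, _root_.expTilt, tilted_tilted (h.integrable (by fun_prop)), _root_.expTilt]
  congr 1
  ext x
  simp [inner_add_left]

lemma hasFDerivAt_integral_exp_mul (h : IsCompactLogConcave P p ρ) {g : EucSp n → ℝ}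
    (hg : Continuous g) (ξ : EucSp n) :
    HasFDerivAt (fun ξ => ∫ x, rexp ⟪ξ, x⟫ * g x ∂P)
      (innerSL ℝ (∫ x, (rexp ⟪ξ, x⟫ * g x) • x ∂P)) ξ := by
  have := h.prob
  have e : innerSL ℝ (∫ x, (rexp ⟪ξ, x⟫ * g x) • x ∂P) =
      ∫ x, (rexp ⟪ξ, x⟫ * g x) • innerSL ℝ x ∂P := by
    rw [← ContinuousLinearMap.integral_comp_comm _ (h.integrable (by fun_prop))]
    simp
  rw [e]
  obtain ⟨c, hc0, hc⟩ := h.exists_bound hg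
  refine hasFDerivAt_integral_of_dominated_of_fderiv_le (s := Metric.ball ξ 1)
    (F' := fun ξ x => (rexp ⟪ξ, x⟫ * g x) • innerSL ℝ x)
    (bound := fun _ => rexp ((‖ξ‖ + 1) * ρ) * c * ρ)
    (Metric.ball_mem_nhds _ one_pos) (Eventually.of_forall fun η =>
      Continuous.aestronglyMeasurable (by fun_prop)) (h.integrable (by fun_prop))
    (Continuous.aestronglyMeasurable (by fun_prop)) ?_ (integrable_const _) ?_
  · filter_upwards [hc, h.ae_norm_le] with x hx hx2 η hη
    rw [norm_smul, innerSL_apply_norm, norm_mul, Real.norm_of_nonneg (exp_pos _).le]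
    have h1 : ‖η‖ ≤ ‖ξ‖ + 1 := by
      have := norm_sub_norm_le η ξ
      rw [Metric.mem_ball, dist_eq_norm] at hη
      linarith
    have h2 : ⟪η, x⟫ ≤ (‖ξ‖ + 1) * ρ := (real_inner_le_norm _ _).trans (by gcongr)
    gcongr
  · refine Eventually.of_forall fun x η _ => ?_
    have h1 : HasFDerivAt (fun ξ : EucSp n => ⟪ξ, x⟫) (innerSL ℝ x) η := by
      have := (innerSL ℝ x).hasFDerivAt (x := η)
      refine this.congr_of_eventuallyEq (Eventually.of_forall fun y => ?_)
      simp [real_inner_comm]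
    have h2 := (h1.exp).mul_const (g x)
    exact h2.congr_fderiv (by rw [smul_smul, mul_comm])

/-- The derivative of tilted averages is a covariance. -/
lemma hasFDerivAt_integral_expTilt (h : IsCompactLogConcave P p ρ) {g : EucSp n → ℝ}
    (hg : Continuous g) (ξ : EucSp n) :
    HasFDerivAt (fun ξ => ∫ x, g x ∂(_root_.expTilt P ξ))
      (innerSL ℝ (∫ x, g x • (x - bary (_root_.expTilt P ξ)) ∂(_root_.expTilt P ξ))) ξ := by
  have hZ := h.laplace_pos ξ
  have d1 := h.hasFDerivAt_integral_exp_mul hg ξ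
  have d2 : HasFDerivAt (laplace P) (innerSL ℝ (∫ x, rexp ⟪ξ, x⟫ • x ∂P)) ξ := by
    have := h.hasFDerivAt_integral_exp_mul (g := fun _ => 1) continuous_const ξ
    simp only [mul_one] at this
    exact this
  have d3 := (hasDerivAt_inv hZ.ne').comp_hasFDerivAt ξ d2
  have d4 := d3.mul d1
  simp only [integral_expTilt, smul_eq_mul]
  refine d4.congr_fderiv ?_
  have e : ∫ x, rexp ⟪ξ, x⟫ • g x • (x - bary (_root_.expTilt P ξ)) ∂P =
      (∫ x, (rexp ⟪ξ, x⟫ * g x) • x ∂P) -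
        (∫ x, rexp ⟪ξ, x⟫ * g x ∂P) • bary (_root_.expTilt P ξ) := by
    rw [← integral_smul_const, ← integral_sub (h.integrable (by fun_prop))
      (h.integrable (by fun_prop))]
    refine integral_congr_ae (Eventually.of_forall fun x => ?_)
    simp only [smul_sub, smul_smul]
  rw [e, bary, integral_expTilt, smul_sub, map_sub, map_smul, map_smul, map_smul, map_smul]
  simp only [Function.comp_apply]
  module

end IsCompactLogConcave

open scoped MatrixOrder Matrix.Norms.L2Operator in
lemma Matrix.PosDef.exists_isUnit_mul_self {n : ℕ} {M : Matrix (Fin n) (Fin n) ℝ}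
    (hM : M.PosDef) : ∃ S : Matrix (Fin n) (Fin n) ℝ, IsUnit S ∧ star S = S ∧ M = S * S :=
  CStarAlgebra.isStrictlyPositive_iff_exists_isUnit_and_isSelfAdjoint_and_eq_mul_self.1
    hM.isStrictlyPositive

lemma volume_hyperplane {n : ℕ} {v : EucSp n} (hv : v ≠ 0) (c : ℝ) :
    volume {x : EucSp n | ⟪x, v⟫ = c} = 0 := by
  have h0 : volume ((LinearMap.ker (innerₛₗ ℝ v) : Submodule ℝ (EucSp n)) : Set (EucSp n)) = 0 := by
    refine Measure.addHaar_submodule _ _ fun h => hv ?_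
    have : v ∈ LinearMap.ker (innerₛₗ ℝ v) := by rw [h]; trivial
    simpa using this
  have : {x : EucSp n | ⟪x, v⟫ = c} = (fun x => x + (-(c / ‖v‖ ^ 2) • v)) ⁻¹'
      (LinearMap.ker (innerₛₗ ℝ v) : Submodule ℝ (EucSp n)) := by
    ext x
    have hv' : ‖v‖ ≠ 0 := norm_ne_zero_iff.2 hv
    simp only [mem_ofPred_eq, mem_preimage, SetLike.mem_coe, LinearMap.mem_ker, innerₛₗ_apply_apply,
      inner_add_right, inner_smul_right, real_inner_self_eq_norm_sq, real_inner_comm v x]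
    have : -(c / ‖v‖ ^ 2) * ‖v‖ ^ 2 = -c := by field_simp
    rw [this]
    constructor <;> intro h <;> linarith
  rw [this, measure_preimage_add_right, h0]

/-- The covariance matrix of a measure. -/
noncomputable def covMat {n : ℕ} (P : Measure (EucSp n)) : Matrix (Fin n) (Fin n) ℝ :=
  Matrix.of fun i j => ∫ x, (x - bary P) i * (x - bary P) j ∂P

/-- The contraction of the third central moment tensor of a measure with a vector. -/
noncomputable def thirdMat {n : ℕ} (P : Measure (EucSp n)) (ξ : EucSp n) :
    Matrix (Fin n) (Fin n) ℝ :=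
  Matrix.of fun i j => ∫ x, (x - bary P) i * (x - bary P) j * ⟪x - bary P, ξ⟫ ∂P

namespace IsCompactLogConcave

variable {n : ℕ} {P : Measure (EucSp n)} {p : EucSp n → ℝ} {ρ : ℝ}

lemma inner_covMat (h : IsCompactLogConcave P p ρ) (u v : EucSp n) :
    ⟪u, Matrix.toEuclideanCLM (𝕜 := ℝ) (covMat P) v⟫ =
      ∫ x, ⟪x - bary P, u⟫ * ⟪x - bary P, v⟫ ∂P := by
  rw [Matrix.inner_toEuclideanCLM]
  simp only [dotProduct, Matrix.mulVec, covMat, Matrix.of_apply, Finset.mul_sum]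
  have : ∀ x : EucSp n, ⟪x - bary P, u⟫ * ⟪x - bary P, v⟫ =
      ∑ i, ∑ j, u i * (v j * ((x - bary P) i * (x - bary P) j)) := by
    intro x
    rw [PiLp.inner_apply, PiLp.inner_apply, Finset.sum_mul_sum]
    refine Finset.sum_congr rfl fun i _ => Finset.sum_congr rfl fun j _ => ?_
    simp only [RCLike.inner_apply, conj_trivial]
    ring
  simp_rw [this]
  rw [integral_finsetSum _ fun i _ => h.integrable (by fun_prop)]
  refine Finset.sum_congr rfl fun i _ => ?_
  rw [integral_finsetSum _ fun i _ => h.integrable (by fun_prop)]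
  refine Finset.sum_congr rfl fun j _ => ?_
  rw [integral_const_mul, integral_const_mul]
  ring

lemma integral_inner_sub_bary_sq_pos (h : IsCompactLogConcave P p ρ) {v : EucSp n} (hv : v ≠ 0) :
    0 < ∫ x, ⟪x - bary P, v⟫ ^ 2 ∂P := by
  have := h.prob
  have hi : Integrable (fun x => ⟪x - bary P, v⟫ ^ 2) P := h.integrable (by fun_prop)
  refine lt_of_le_of_ne (integral_nonneg fun x => sq_nonneg _) fun h0 => ?_
  have h1 := (integral_eq_zero_iff_of_nonneg (fun x => sq_nonneg _) hi).1 h0.symm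
  have hac : P ≪ volume := by
    rw [h.eq_withDensity]; exact withDensity_absolutelyContinuous _ _
  have h2 : P {x : EucSp n | ⟪x, v⟫ = ⟪bary P, v⟫} = 0 := hac (volume_hyperplane hv _)
  have h3 : ∀ᵐ x ∂P, False := by
    filter_upwards [h1, measure_eq_zero_iff_ae_notMem.1 h2] with x hx hx2
    refine hx2 ?_
    have : ⟪x - bary P, v⟫ = 0 := by simpa using hx
    rw [inner_sub_left] at this
    exact sub_eq_zero.1 this
  simp at h3
  exact IsProbabilityMeasure.ne_zero P h3

lemma covMat_posDef (h : IsCompactLogConcave P p ρ) : (covMat P).PosDef := by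
  rw [Matrix.posDef_iff_dotProduct_mulVec]
  refine ⟨?_, fun v hv => ?_⟩
  · ext i j
    simp [covMat, mul_comm]
  · have h1 := h.integral_inner_sub_bary_sq_pos (v := WithLp.toLp 2 v) (by simpa using hv)
    have h2 := h.inner_covMat (WithLp.toLp 2 v) (WithLp.toLp 2 v)
    rw [Matrix.inner_toEuclideanCLM] at h2
    simp_rw [← sq] at h2
    rw [← h2] at h1
    simpa using h1

/-- An affine image of a log-concave measure is log-concave. -/
lemma map_affine (h : IsCompactLogConcave P p ρ) (A : EucSp n ≃L[ℝ] EucSp n) (b : EucSp n) :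
    ∃ q, IsLogConcaveFn q ∧
      P.map (fun x => A (x - b)) = volume.withDensity fun y => ENNReal.ofReal (q y) := by
  have hdet : LinearMap.det (A : EucSp n →ₗ[ℝ] EucSp n) ≠ 0 :=
    (LinearEquiv.isUnit_det' A.toLinearEquiv).ne_zero
  set d := |(LinearMap.det (A : EucSp n →ₗ[ℝ] EucSp n))⁻¹| with hd
  have hd0 : 0 < d := abs_pos.2 (inv_ne_zero hdet)
  have hm : Measurable fun x : EucSp n => A (x - b) := by fun_prop
  refine ⟨fun y => d * p (A.symm y + b), ⟨fun y => mul_nonneg hd0.le (h.logConcave.1 _),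
    fun x y l hl => ?_⟩, ?_⟩
  · rw [mul_rpow hd0.le (h.logConcave.1 _), mul_rpow hd0.le (h.logConcave.1 _), mul_mul_mul_comm,
      ← rpow_add hd0, sub_add_cancel, rpow_one]
    refine mul_le_mul_of_nonneg_left ?_ hd0.le
    have e : A.symm ((1 - l) • x + l • y) + b =
        (1 - l) • (A.symm x + b) + l • (A.symm y + b) := by
      rw [map_add, map_smul, map_smul]
      module
    beta_reduce
    rw [e]
    exact h.logConcave.2 (A.symm x + b) (A.symm y + b) l hl
  · ext s hs
    rw [Measure.map_apply hm hs, withDensity_apply _ hs, h.eq_withDensity,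
      withDensity_apply _ (hm hs), ← lintegral_indicator (hm hs), ← lintegral_indicator hs]
    set G : EucSp n → ℝ≥0∞ := s.indicator fun y => ENNReal.ofReal (p (A.symm y + b)) with hG
    have e1 : ∀ x, ((fun x => A (x - b)) ⁻¹' s).indicator (fun x => ENNReal.ofReal (p x)) x =
        G (A (x - b)) := by
      intro x
      by_cases hx : A (x - b) ∈ s
      · rw [hG, indicator_of_mem hx, indicator_of_mem (by exact hx)]; simp
      · rw [hG, indicator_of_notMem hx, indicator_of_notMem (by exact hx)]
    have e2 : ∀ y, s.indicator (fun y => ENNReal.ofReal (d * p (A.symm y + b))) y =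
        ENNReal.ofReal d * G y := by
      intro y
      by_cases hy : y ∈ s
      · rw [hG, indicator_of_mem hy, indicator_of_mem hy, ENNReal.ofReal_mul hd0.le]
      · rw [hG, indicator_of_notMem hy, indicator_of_notMem hy, mul_zero]
    simp_rw [e1, e2]
    rw [lintegral_const_mul' _ _ ENNReal.ofReal_ne_top,
      lintegral_sub_right_eq_self (fun x => G (A x)) b]
    have e3 := lintegral_map_equiv (μ := (volume : Measure (EucSp n))) G
      A.toHomeomorph.toMeasurableEquiv
    have e4 := Measure.map_linearMap_addHaar_eq_smul_addHaar (volume : Measure (EucSp n)) hdet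
    change ∫⁻ a, G a ∂(Measure.map (A : EucSp n →ₗ[ℝ] EucSp n) volume) = ∫⁻ a, G (A a) at e3
    rw [← e3, e4, lintegral_smul_measure, smul_eq_mul]

/-- The logarithmic derivative of the determinant of the covariance matrix along a tilt is
controlled by the thin-shell constant. -/
lemma abs_trace_inv_mul_thirdMat_le (h : IsCompactLogConcave P p ρ) (hn : 1 ≤ n) (ξ : EucSp n)
    {a : ℝ} (ha : 0 < a) :
    |((covMat P)⁻¹ * thirdMat P ξ).trace| ≤
      (a * (62500 * n * sigmaN n ^ 2) + (∫ x, ⟪x - bary P, ξ⟫ ^ 2 ∂P) / a) / 2 := by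
  have := h.prob
  obtain ⟨S, hS, hSt, hM⟩ := h.covMat_posDef.exists_isUnit_mul_self
  have hSd : IsUnit S.det := (Matrix.isUnit_iff_isUnit_det S).1 hS
  set L := Matrix.toEuclideanCLM (n := Fin n) (𝕜 := ℝ) with hL
  have hLS : ContinuousLinearMap.adjoint (L S) = L S := by
    have := map_star L S
    rw [hSt] at this; exact this.symm
  have hLW : ContinuousLinearMap.adjoint (L S⁻¹) = L S⁻¹ := by
    have := map_star L S⁻¹
    rw [Matrix.star_eq_conjTranspose, Matrix.conjTranspose_nonsing_inv,
      ← Matrix.star_eq_conjTranspose, hSt] at this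
    exact this.symm
  have hWS : ∀ v, L S⁻¹ (L S v) = v := by
    intro v
    rw [← mul_apply_eq_comp, ← map_mul, Matrix.nonsing_inv_mul _ hSd, map_one]; rfl
  have hSW : ∀ v, L S (L S⁻¹ v) = v := by
    intro v
    rw [← mul_apply_eq_comp, ← map_mul, Matrix.mul_nonsing_inv _ hSd, map_one]; rfl
  let A : EucSp n ≃L[ℝ] EucSp n := ContinuousLinearEquiv.equivOfInverse (L S⁻¹) (L S) hSW hWS
  have hA : ∀ v, A v = L S⁻¹ v := fun v => rfl
  obtain ⟨q, hq, hν⟩ := h.map_affine A (bary P)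
  have hm : Measurable fun x : EucSp n => A (x - bary P) := by fun_prop
  set ν := P.map (fun x => A (x - bary P)) with hνdef
  have hνp : IsProbabilityMeasure ν := Measure.isProbabilityMeasure_map hm.aemeasurable
  have hinner : ∀ x u : EucSp n, ⟪A x, u⟫ = ⟪x, L S⁻¹ u⟫ := by
    intro x u
    rw [hA, ← ContinuousLinearMap.adjoint_inner_right, hLW]
  have hiso : IsIsotropic ν := by
    constructor
    · rw [hνdef, integral_map hm.aemeasurable (by fun_prop)]
      have e := A.toContinuousLinearMap.integral_comp_comm
        (h.integrable (g := fun x => x - bary P) (by fun_prop))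
      refine e.trans ?_
      rw [integral_sub (h.integrable (g := fun x => x) continuous_id) (integrable_const _)]
      simp [bary]
    · intro u v
      rw [hνdef, integral_map hm.aemeasurable (by fun_prop)]
      simp_rw [hinner]
      rw [← h.inner_covMat, hM, ← hL, map_mul, mul_apply_eq_comp, hSW,
        ← ContinuousLinearMap.adjoint_inner_left, hLS, hSW]
  have key := hiso.abs_integral_norm_sq_mul_inner_le hn hq hν (L S ξ) ha
  rw [hνdef, integral_map hm.aemeasurable (by fun_prop)] at key
  have e1 : ‖L S ξ‖ ^ 2 = ∫ x, ⟪x - bary P, ξ⟫ ^ 2 ∂P := by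
    rw [← real_inner_self_eq_norm_sq, ← ContinuousLinearMap.adjoint_inner_right, hLS,
      ← mul_apply_eq_comp, ← map_mul, ← hM, h.inner_covMat]
    simp_rw [sq]
  rw [e1] at key
  convert key using 2
  have hinv : (covMat P)⁻¹ = S⁻¹ * S⁻¹ := by rw [hM, Matrix.mul_inv_rev]
  have e2 : ∀ x : EucSp n, ‖A (x - bary P)‖ ^ 2 * ⟪A (x - bary P), L S ξ⟫ =
      ∑ i, ∑ j, (covMat P)⁻¹ i j * ((x - bary P) j * (x - bary P) i * ⟪x - bary P, ξ⟫) := by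
    intro x
    rw [hinner, hWS]
    have : ‖A (x - bary P)‖ ^ 2 = ⟪x - bary P, L (covMat P)⁻¹ (x - bary P)⟫ := by
      rw [← real_inner_self_eq_norm_sq, hinner, hinv, map_mul, mul_apply_eq_comp, hA]
    rw [this, hL, Matrix.inner_toEuclideanCLM]
    simp only [dotProduct, Matrix.mulVec, Finset.mul_sum, Finset.sum_mul]
    refine Finset.sum_congr rfl fun i _ => Finset.sum_congr rfl fun j _ => ?_
    ring
  simp_rw [e2]
  rw [Matrix.trace, integral_finsetSum _ fun i _ => h.integrable (by fun_prop)]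
  refine Finset.sum_congr rfl fun i _ => ?_
  rw [integral_finsetSum _ fun i _ => h.integrable (by fun_prop), Matrix.diag_apply,
    Matrix.mul_apply]
  refine Finset.sum_congr rfl fun j _ => ?_
  rw [integral_const_mul, thirdMat, Matrix.of_apply]

end IsCompactLogConcave

lemma Matrix.hasDerivAt_det_aux {n : ℕ} {M : ℝ → Matrix (Fin n) (Fin n) ℝ}
    {M' : Matrix (Fin n) (Fin n) ℝ} {t : ℝ}
    (hM : ∀ i j, HasDerivAt (fun s => M s i j) (M' i j) t) :
    HasDerivAt (fun s => (M s).det) (∑ σ : Equiv.Perm (Fin n), ((Equiv.Perm.sign σ : ℤ) : ℝ) *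
      ∑ i, (∏ j ∈ Finset.univ.erase i, M t (σ j) j) • M' (σ i) i) t := by
  simp only [Matrix.det_apply']
  exact HasDerivAt.fun_sum fun σ _ =>
    (HasDerivAt.fun_finsetProd fun i _ => hM (σ i) i).const_mul _

lemma Matrix.hasDerivAt_det_of_eq_one {n : ℕ} {M : ℝ → Matrix (Fin n) (Fin n) ℝ}
    {M' : Matrix (Fin n) (Fin n) ℝ} {t : ℝ}
    (hM : ∀ i j, HasDerivAt (fun s => M s i j) (M' i j) t) (h1 : M t = 1) :
    HasDerivAt (fun s => (M s).det) M'.trace t := by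
  have a1 := Matrix.hasDerivAt_det_aux hM
  have a2 := Matrix.hasDerivAt_det_aux (M := fun s => 1 + s • M') (M' := M') (t := 0) fun i j => by
    simpa using ((hasDerivAt_id (0:ℝ)).mul_const (M' i j)).const_add ((1 : Matrix _ _ ℝ) i j)
  have a3 : HasDerivAt (fun s : ℝ => (1 + s • M').det) M'.trace 0 := by
    let Q := (1 + (Polynomial.X : Polynomial ℝ) • M'.map Polynomial.C).det.divX.divX
    have b1 := ((hasDerivAt_id (0:ℝ)).const_mul M'.trace).const_add 1
    have b2 := (Q.hasDerivAt 0).mul (hasDerivAt_pow 2 (0:ℝ))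
    refine ((b1.add b2).congr_deriv ?_).congr_of_eventuallyEq
      (Eventually.of_forall fun s => Matrix.det_one_add_smul s M')
    simp
  have := a2.unique a3
  simp only [zero_smul, add_zero] at this
  rw [h1, this] at a1
  exact a1

/-- Jacobi's formula at an invertible matrix. -/
lemma Matrix.hasDerivAt_det {n : ℕ} {M : ℝ → Matrix (Fin n) (Fin n) ℝ}
    {M' : Matrix (Fin n) (Fin n) ℝ} {t : ℝ}
    (hM : ∀ i j, HasDerivAt (fun s => M s i j) (M' i j) t) (h0 : IsUnit (M t).det) :
    HasDerivAt (fun s => (M s).det) ((M t).det * ((M t)⁻¹ * M').trace) t := by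
  have h1 : ∀ s, (M s).det = (M t).det * ((M t)⁻¹ * M s).det := by
    intro s
    rw [← Matrix.det_mul, Matrix.mul_nonsing_inv_cancel_left _ _ h0]
  have h2 := Matrix.hasDerivAt_det_of_eq_one (M := fun s => (M t)⁻¹ * M s) (M' := (M t)⁻¹ * M')
    (t := t) (fun i j => by
      simp only [Matrix.mul_apply]
      exact HasDerivAt.fun_sum fun k _ => (hM k j).const_mul _)
    (Matrix.nonsing_inv_mul _ h0)
  have h3 := h2.const_mul (M t).det
  exact h3.congr_of_eventuallyEq (Eventually.of_forall h1)

/-- A symmetric matrix bounded below by `c` has determinant at least `c ^ n`. -/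
lemma Matrix.PosDef.pow_le_det {n : ℕ} {M : Matrix (Fin n) (Fin n) ℝ} (hM : M.PosDef) {c : ℝ}
    (hc : 0 ≤ c) (h : ∀ u : EucSp n, c * ‖u‖ ^ 2 ≤ ⟪u, Matrix.toEuclideanCLM (𝕜 := ℝ) M u⟫) :
    c ^ n ≤ M.det := by
  rw [hM.isHermitian.det_eq_prod_eigenvalues]
  have : ∏ _i : Fin n, c = c ^ n := by simp
  rw [← this]
  refine Finset.prod_le_prod (fun _ _ => hc) fun i _ => ?_
  have h1 := h (hM.isHermitian.eigenvectorBasis i)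
  rw [Matrix.inner_toEuclideanCLM, hM.isHermitian.mulVec_eigenvectorBasis] at h1
  have h2 : ‖hM.isHermitian.eigenvectorBasis i‖ = 1 :=
    hM.isHermitian.eigenvectorBasis.orthonormal.1 i
  have h3 : ‖hM.isHermitian.eigenvectorBasis i‖ ^ 2 =
    (hM.isHermitian.eigenvectorBasis i).ofLp ⬝ᵥ (hM.isHermitian.eigenvectorBasis i).ofLp := by
    rw [← real_inner_self_eq_norm_sq]; rfl
  simp only [dotProduct_smul, smul_eq_mul] at h1
  rw [← h3, h2] at h1
  simpa using h1

namespace IsCompactLogConcave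

variable {n : ℕ} {P : Measure (EucSp n)} {p : EucSp n → ℝ} {ρ : ℝ}

lemma integral_coord (h : IsCompactLogConcave P p ρ) (i : Fin n) : ∫ x, x i ∂P = bary P i := by
  have := (PiLp.proj 2 (fun _ : Fin n => ℝ) i : EucSp n →L[ℝ] ℝ).integral_comp_comm
    (h.integrable (g := fun x => x) continuous_id)
  exact this

lemma hasDerivAt_integral_expTilt_smul (h : IsCompactLogConcave P p ρ) {g : EucSp n → ℝ}
    (hg : Continuous g) (ξ : EucSp n) (t : ℝ) :
    HasDerivAt (fun t : ℝ => ∫ x, g x ∂(_root_.expTilt P (t • ξ)))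
      (∫ x, g x * ⟪x - bary (_root_.expTilt P (t • ξ)), ξ⟫ ∂(_root_.expTilt P (t • ξ))) t := by
  have h1 := h.hasFDerivAt_integral_expTilt hg (t • ξ)
  have h2 : HasDerivAt (fun t : ℝ => t • ξ) ξ t := by
    simpa using (hasDerivAt_id t).smul_const ξ
  refine (h1.comp_hasDerivAt t h2).congr_deriv ?_
  rw [innerSL_apply_apply, real_inner_comm,
    ← _root_.integral_inner ((h.expTilt (t • ξ)).integrable (by fun_prop))]
  refine integral_congr_ae (Eventually.of_forall fun x => ?_)
  simp only [inner_smul_right]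
  rw [real_inner_comm]

lemma hasDerivAt_covMat (h : IsCompactLogConcave P p ρ) (ξ : EucSp n) (t : ℝ) (i j : Fin n) :
    HasDerivAt (fun t : ℝ => covMat (_root_.expTilt P (t • ξ)) i j)
      (thirdMat (_root_.expTilt P (t • ξ)) ξ i j) t := by
  set V := bary (_root_.expTilt P (t • ξ)) with hV
  have hc : ∀ s : ℝ, covMat (_root_.expTilt P (s • ξ)) i j =
      ∫ x, (x - V) i * (x - V) j ∂(_root_.expTilt P (s • ξ)) -
        (∫ x, (x - V) i ∂(_root_.expTilt P (s • ξ))) *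
          (∫ x, (x - V) j ∂(_root_.expTilt P (s • ξ))) := by
    intro s
    have hs := h.expTilt (s • ξ)
    have := hs.prob
    have e1 : ∀ k, ∫ x, (x - V) k ∂(_root_.expTilt P (s • ξ)) =
        (bary (_root_.expTilt P (s • ξ)) - V) k := by
      intro k
      simp only [PiLp.sub_apply]
      rw [integral_sub (hs.integrable (by fun_prop)) (integrable_const _), hs.integral_coord]
      simp
    rw [e1, e1, covMat, Matrix.of_apply]
    set U := bary (_root_.expTilt P (s • ξ)) with hU
    have e2 : ∀ x : EucSp n, (x - U) i * (x - U) j = (x - V) i * (x - V) j -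
        ((U - V) j * (x - V) i + (U - V) i * (x - V) j - (U - V) i * (U - V) j) := by
      intro x; simp only [PiLp.sub_apply]; ring
    simp_rw [e2]
    rw [integral_sub (hs.integrable (by fun_prop)) (hs.integrable (by fun_prop)),
      integral_sub (hs.integrable (by fun_prop)) (hs.integrable (by fun_prop)),
      integral_add (hs.integrable (by fun_prop)) (hs.integrable (by fun_prop)),
      integral_const_mul, integral_const_mul, e1, e1]
    simp
    ring
  simp only [hc]
  have d1 := h.hasDerivAt_integral_expTilt_smul (g := fun x => (x - V) i * (x - V) j)
    (by fun_prop) ξ t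
  have d2 := h.hasDerivAt_integral_expTilt_smul (g := fun x => (x - V) i) (by fun_prop) ξ t
  have d3 := h.hasDerivAt_integral_expTilt_smul (g := fun x => (x - V) j) (by fun_prop) ξ t
  refine (d1.sub (d2.mul d3)).congr_deriv ?_
  have z : ∀ k, ∫ x, (x - V) k ∂(_root_.expTilt P (t • ξ)) = 0 := by
    intro k
    have ht := h.expTilt (t • ξ)
    have := ht.prob
    simp only [PiLp.sub_apply]
    rw [integral_sub (ht.integrable (by fun_prop)) (integrable_const _), ht.integral_coord]
    simp [hV]
  rw [z, z, thirdMat, Matrix.of_apply]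
  simp [← hV]

lemma hasDerivAt_log_det_covMat (h : IsCompactLogConcave P p ρ) (ξ : EucSp n) (t : ℝ) :
    HasDerivAt (fun t : ℝ => log (covMat (_root_.expTilt P (t • ξ))).det)
      ((covMat (_root_.expTilt P (t • ξ)))⁻¹ * thirdMat (_root_.expTilt P (t • ξ)) ξ).trace t := by
  have hp := (h.expTilt (t • ξ)).covMat_posDef.det_pos
  have := (Matrix.hasDerivAt_det (h.hasDerivAt_covMat ξ t) hp.ne'.isUnit).log hp.ne'
  refine this.congr_deriv ?_
  field_simp

lemma hasDerivAt_inner_bary (h : IsCompactLogConcave P p ρ) (ξ : EucSp n) (t : ℝ) :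
    HasDerivAt (fun t : ℝ => ⟪bary (_root_.expTilt P (t • ξ)), ξ⟫)
      (∫ x, ⟪x - bary (_root_.expTilt P (t • ξ)), ξ⟫ ^ 2 ∂(_root_.expTilt P (t • ξ))) t := by
  have := h.hasDerivAt_integral_expTilt_smul (g := fun x => ⟪x, ξ⟫) (by fun_prop) ξ t
  have ht := h.expTilt (t • ξ)
  simp only [fun t : ℝ => (h.expTilt (t • ξ)).inner_bary ξ] at this
  refine this.congr_deriv ?_
  set V := bary (_root_.expTilt P (t • ξ)) with hV
  have e : ∀ x : EucSp n, ⟪x, ξ⟫ * ⟪x - V, ξ⟫ = ⟪x - V, ξ⟫ ^ 2 + ⟪V, ξ⟫ * ⟪x - V, ξ⟫ := by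
    intro x; simp only [inner_sub_left]; ring
  simp_rw [e]
  have := ht.prob
  rw [integral_add (ht.integrable (by fun_prop)) (ht.integrable (by fun_prop)),
    integral_const_mul]
  have z : ∫ x, ⟪x - V, ξ⟫ ∂(_root_.expTilt P (t • ξ)) = 0 := by
    simp only [inner_sub_left]
    rw [integral_sub (ht.integrable (by fun_prop)) (integrable_const _), ht.inner_bary]
    simp [hV]
  rw [z]; ring

lemma log_det_covMat_expTilt_ge (h : IsCompactLogConcave P p ρ) (hn : 1 ≤ n) (ξ : EucSp n)
    {a : ℝ} (ha : 0 < a) :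
    log (covMat P).det - (a * (62500 * n * sigmaN n ^ 2) +
      (⟪bary (_root_.expTilt P ξ), ξ⟫ - ⟪bary P, ξ⟫) / a) / 2 ≤
        log (covMat (_root_.expTilt P ξ)).det := by
  have h0 : _root_.expTilt P 0 = P := by
    have := h.prob
    simp [_root_.expTilt]
  let F : ℝ → ℝ := fun t => log (covMat (_root_.expTilt P (t • ξ))).det +
    (t * (a * (62500 * n * sigmaN n ^ 2)) + ⟪bary (_root_.expTilt P (t • ξ)), ξ⟫ / a) / 2
  have hF : ∀ t, HasDerivAt F (((covMat (_root_.expTilt P (t • ξ)))⁻¹ *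
      thirdMat (_root_.expTilt P (t • ξ)) ξ).trace + (1 * (a * (62500 * n * sigmaN n ^ 2)) +
        (∫ x, ⟪x - bary (_root_.expTilt P (t • ξ)), ξ⟫ ^ 2 ∂(_root_.expTilt P (t • ξ))) / a) / 2) t :=
    fun t => (h.hasDerivAt_log_det_covMat ξ t).add
      ((((hasDerivAt_id t).mul_const _).add ((h.hasDerivAt_inner_bary ξ t).div_const a)).div_const 2)
  have hmono : Monotone F := by
    refine monotone_of_deriv_nonneg (fun t => (hF t).differentiableAt) fun t => ?_
    rw [(hF t).deriv]
    have := neg_le_of_abs_le ((h.expTilt (t • ξ)).abs_trace_inv_mul_thirdMat_le hn ξ ha)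
    linarith
  have := hmono zero_le_one
  simp only [F, zero_smul, one_smul, h0] at this
  rw [sub_div]
  linarith

end IsCompactLogConcave

lemma laplace_expTilt {n : ℕ} (P : Measure (EucSp n)) (ξ η : EucSp n) :
    laplace (expTilt P ξ) η = laplace P (ξ + η) / laplace P ξ := by
  rw [laplace, integral_expTilt, smul_eq_mul, div_eq_inv_mul]
  simp only [smul_eq_mul, ← exp_add, ← inner_add_left]
  rfl

namespace IsCompactLogConcave

variable {n : ℕ} {P : Measure (EucSp n)} {p : EucSp n → ℝ} {ρ : ℝ}

lemma exp_inner_bary_le (h : IsCompactLogConcave P p ρ) (ξ : EucSp n) :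
    rexp ⟪bary P, ξ⟫ ≤ laplace P ξ := by
  have := h.prob
  have h1 := convexOn_exp.map_integral_le (μ := P) (f := fun x : EucSp n => ⟪x, ξ⟫)
    continuous_exp.continuousOn isClosed_univ (Eventually.of_forall fun _ => mem_univ _)
    (h.integrable (by fun_prop)) (h.integrable (g := rexp ∘ fun x : EucSp n => ⟪x, ξ⟫)
      (continuous_exp.comp (by fun_prop)))
  rw [h.inner_bary] at h1
  simpa [laplace, real_inner_comm] using h1

lemma log_det_covMat_expTilt_ge_neg (h : IsCompactLogConcave P p ρ) (hn : 1 ≤ n)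
    (hvar : ∀ u : EucSp n, ‖u‖ ^ 2 / 2 ≤ ∫ x, ⟪x - bary P, u⟫ ^ 2 ∂P) (ξ : EucSp n)
    {r : ℝ} (hr : 0 < r) (hr2 : r * (62500 * sigmaN n ^ 2) ≤ n)
    (hξ : laplace P ((2 : ℝ) • ξ) ≤ rexp (r + 2 * ⟪bary P, ξ⟫)) :
    ((2 * rexp 1)⁻¹) ^ n ≤ (covMat (_root_.expTilt P ξ)).det := by
  have hn0 : (0:ℝ) < n := by exact_mod_cast hn
  have hξ2 := h.expTilt ξ
  have h1 := h.log_det_covMat_expTilt_ge hn ξ (a := r / n) (by positivity)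
  have h2 := hξ2.exp_inner_bary_le ξ
  rw [laplace_expTilt, ← two_smul ℝ ξ, le_div_iff₀ (h.laplace_pos ξ)] at h2
  have h3 : rexp ⟪bary (_root_.expTilt P ξ), ξ⟫ * rexp ⟪bary P, ξ⟫ ≤
      rexp (r + 2 * ⟪bary P, ξ⟫) :=
    (mul_le_mul_of_nonneg_left (h.exp_inner_bary_le ξ) (exp_pos _).le).trans (h2.trans hξ)
  rw [← exp_add, exp_le_exp] at h3
  have h4 : (⟪bary (_root_.expTilt P ξ), ξ⟫ - ⟪bary P, ξ⟫) / (r / n) ≤ n := by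
    rw [div_le_iff₀ (by positivity)]
    field_simp
    linarith
  have h5 : r / n * (62500 * n * sigmaN n ^ 2) ≤ n := by
    calc r / n * (62500 * n * sigmaN n ^ 2) = r * (62500 * sigmaN n ^ 2) := by field_simp
      _ ≤ (n:ℝ) := hr2
  have h6 : (1 / 2 : ℝ) ^ n ≤ (covMat P).det := by
    refine h.covMat_posDef.pow_le_det (by norm_num) fun u => ?_
    rw [h.inner_covMat]
    have := hvar u
    simp_rw [← sq]
    linarith
  have h7 : n * log (1 / 2) ≤ log (covMat P).det := by
    rw [← log_pow]
    exact log_le_log (by positivity) h6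
  rw [← log_le_log_iff (by positivity) hξ2.covMat_posDef.det_pos, log_pow, log_inv,
    log_mul (by norm_num) (exp_pos _).ne', log_exp]
  rw [log_div (by norm_num) (by norm_num), log_one] at h7
  linarith

lemma toEuclideanCLM_apply_eq (h : IsCompactLogConcave P p ρ) (v : EucSp n) (i : Fin n) :
    Matrix.toEuclideanCLM (𝕜 := ℝ) (covMat P) v i = ∫ x, x i * ⟪x - bary P, v⟫ ∂P := by
  have := h.prob
  have h1 := h.inner_covMat (EuclideanSpace.single i 1) v
  rw [EuclideanSpace.inner_single_left] at h1
  simp only [map_one, one_mul] at h1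
  rw [h1]
  simp only [EuclideanSpace.inner_single_right, PiLp.sub_apply, one_mul, conj_trivial, sub_mul]
  rw [integral_sub (h.integrable (by fun_prop)) (h.integrable (by fun_prop)),
    integral_const_mul]
  have : ∫ x, ⟪x - bary P, v⟫ ∂P = 0 := by
    simp only [inner_sub_left]
    rw [integral_sub (h.integrable (by fun_prop)) (integrable_const _), h.inner_bary]
    simp
  rw [this, mul_zero, sub_zero]

lemma hasFDerivAt_bary_expTilt (h : IsCompactLogConcave P p ρ) (ξ : EucSp n) :
    HasFDerivAt (fun ξ => bary (_root_.expTilt P ξ))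
      (Matrix.toEuclideanCLM (𝕜 := ℝ) (covMat (_root_.expTilt P ξ)) : EucSp n →L[ℝ] EucSp n) ξ := by
  rw [← hasFDerivWithinAt_univ, hasFDerivWithinAt_euclidean]
  intro i
  rw [hasFDerivWithinAt_univ]
  have h1 := h.hasFDerivAt_integral_expTilt (g := fun x => x i) (by fun_prop) ξ
  simp only [fun ξ : EucSp n => (h.expTilt ξ).integral_coord i] at h1
  refine h1.congr_fderiv ?_
  ext v
  change _ = (Matrix.toEuclideanCLM (𝕜 := ℝ) (covMat (_root_.expTilt P ξ)) v) i
  rw [(h.expTilt ξ).toEuclideanCLM_apply_eq, innerSL_apply_apply, real_inner_comm,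
    ← _root_.integral_inner ((h.expTilt ξ).integrable (by fun_prop))]
  refine integral_congr_ae (Eventually.of_forall fun x => ?_)
  simp only [inner_smul_right]
  rw [real_inner_comm]

lemma injective_bary_expTilt (h : IsCompactLogConcave P p ρ) :
    Function.Injective fun ξ => bary (_root_.expTilt P ξ) := by
  have key : ∀ ξ η : EucSp n, η ≠ 0 →
      bary (_root_.expTilt P ξ) ≠ bary (_root_.expTilt P (ξ + η)) := by
    intro ξ η hη heq
    have hξ := h.expTilt ξ
    have := hξ.prob
    have hmono : StrictMono fun t : ℝ =>
        ⟪bary (_root_.expTilt (_root_.expTilt P ξ) (t • η)), η⟫ := by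
      refine strictMono_of_deriv_pos fun t => ?_
      rw [(hξ.hasDerivAt_inner_bary η t).deriv]
      exact (hξ.expTilt (t • η)).integral_inner_sub_bary_sq_pos hη
    have := hmono zero_lt_one
    simp only [zero_smul, one_smul, add_zero, h.expTilt_expTilt] at this
    rw [heq] at this
    exact lt_irrefl _ this
  intro ξ η heq
  by_contra hne
  refine key ξ (η - ξ) (sub_ne_zero.2 (Ne.symm hne)) ?_
  rw [add_sub_cancel]
  exact heq

lemma mul_volume_le_volume_image_bary (h : IsCompactLogConcave P p ρ) {S : Set (EucSp n)}
    (hS : MeasurableSet S) {d : ℝ} (hd : ∀ ξ ∈ S, d ≤ (covMat (_root_.expTilt P ξ)).det) :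
    ENNReal.ofReal d * volume S ≤ volume (Set.image (fun ξ => bary (_root_.expTilt P ξ)) S) := by
  rw [← lintegral_abs_det_fderiv_eq_addHaar_image volume hS
    (fun ξ _ => (h.hasFDerivAt_bary_expTilt ξ).hasFDerivWithinAt)
    h.injective_bary_expTilt.injOn, ← setLIntegral_const]
  refine setLIntegral_mono' hS fun ξ hξ => ENNReal.ofReal_le_ofReal ?_
  have : (Matrix.toEuclideanCLM (𝕜 := ℝ) (covMat (_root_.expTilt P ξ)) :
      EucSp n →L[ℝ] EucSp n).det = (covMat (_root_.expTilt P ξ)).det := by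
    rw [ContinuousLinearMap.det, Matrix.coe_toEuclideanCLM_eq_toEuclideanLin]
    change LinearMap.det (Matrix.toLpLin 2 2 _) = _
    rw [Matrix.toLpLin_eq_toLin, LinearMap.det_toLin]
  rw [this]
  exact (hd ξ hξ).trans (le_abs_self _)

end IsCompactLogConcave

lemma IsLogConcaveFn.convex_epigraph {n : ℕ} {p : EucSp n → ℝ} (hp : IsLogConcaveFn p) :
    Convex ℝ {z : EucSp n × ℝ | 0 < z.2 ∧ 1 ≤ z.2 ^ 2 * p z.1} := by
  rintro ⟨x, s⟩ ⟨hs, hx⟩ ⟨y, t⟩ ⟨ht, hy⟩ a b ha hb hab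
  obtain rfl : a = 1 - b := by linarith
  simp only at hs hx ht hy
  have h1 := geom_mean_le_arith_mean2_weighted ha hb hs.le ht.le hab
  have hpos : 0 < s ^ (1 - b) * t ^ b := by positivity
  refine ⟨hpos.trans_le h1, ?_⟩
  have h2 := hp.2 x y b ⟨hb, by linarith⟩
  have hx0 := hp.1 x
  have hy0 := hp.1 y
  calc (1:ℝ) ≤ (s ^ 2 * p x) ^ (1 - b) * (t ^ 2 * p y) ^ b := by
        have e1 := one_le_rpow hx ha
        have e2 := one_le_rpow hy hb
        nlinarith
    _ = (s ^ (1 - b) * t ^ b) ^ 2 * (p x ^ (1 - b) * p y ^ b) := by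
        rw [mul_rpow (by positivity) hx0, mul_rpow (by positivity) hy0, mul_pow,
          ← rpow_natCast s, ← rpow_natCast t, ← rpow_natCast (s ^ _), ← rpow_natCast (t ^ _),
          ← rpow_mul hs.le, ← rpow_mul hs.le, ← rpow_mul ht.le, ← rpow_mul ht.le,
          mul_comm (1 - b), mul_comm b]
        ring
    _ ≤ _ := by
        have := mul_nonneg (rpow_nonneg hx0 (1 - b)) (rpow_nonneg hy0 b)
        exact mul_le_mul (pow_le_pow_left₀ hpos.le h1 2) h2 this (by positivity)

namespace IsCompactLogConcave

variable {n : ℕ} {P : Measure (EucSp n)} {p : EucSp n → ℝ} {ρ : ℝ}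

lemma integrable_iff (h : IsCompactLogConcave P p ρ) {g : EucSp n → ℝ} :
    Integrable g P ↔ Integrable (fun x => p x * g x) := by
  rw [h.eq_withDensity, integrable_withDensity_iff_integrable_smul₀'
    h.logConcave.aemeasurable.ennreal_ofReal (Eventually.of_forall fun _ => ENNReal.ofReal_lt_top)]
  simp only [ENNReal.toReal_ofReal (h.logConcave.1 _), smul_eq_mul]

lemma integral_eq (h : IsCompactLogConcave P p ρ) (g : EucSp n → ℝ) :
    ∫ x, g x ∂P = ∫ x, p x * g x := by
  rw [h.eq_withDensity, integral_withDensity_eq_integral_toReal_smul₀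
    h.logConcave.aemeasurable.ennreal_ofReal (Eventually.of_forall fun _ => ENNReal.ofReal_lt_top)]
  simp only [ENNReal.toReal_ofReal (h.logConcave.1 _), smul_eq_mul]

lemma ae_pos (h : IsCompactLogConcave P p ρ) : ∀ᵐ x ∂P, 0 < p x := by
  rw [h.eq_withDensity, ae_withDensity_iff_ae_restrict'
    h.logConcave.aemeasurable.ennreal_ofReal]
  refine (ae_restrict_mem₀ ?_).mono fun x hx => ?_
  · exact (nullMeasurableSet_eq_fun h.logConcave.aemeasurable.ennreal_ofReal
      aemeasurable_const).compl
  · have hx' : ENNReal.ofReal (p x) ≠ 0 := hx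
    exact ENNReal.ofReal_pos.1 (pos_iff_ne_zero.2 hx')

lemma integral_inv_sqrt_le (h : IsCompactLogConcave P p ρ) (h0 : 0 < p 0) (η : EucSp n) :
    Integrable (fun x => (√(p x))⁻¹) (_root_.expTilt P η) ∧
    ∫ x, (√(p x))⁻¹ ∂(_root_.expTilt P η) ≤
      2 ^ n * laplace P ((2 : ℝ) • η) / (laplace P η * √(p 0)) := by
  have hη := h.expTilt η
  have hZ := h.laplace_pos η
  set G : EucSp n → ℝ := fun y => p y * rexp ⟪(2 : ℝ) • η, y⟫ with hG
  have hGi : Integrable G := h.integrable_iff.1 (h.integrable (by fun_prop))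
  have hGe : ∫ y, G y = laplace P ((2 : ℝ) • η) := (h.integral_eq _).symm
  have hGi2 : Integrable (fun x => (laplace P η * √(p 0))⁻¹ * G ((2:ℝ)⁻¹ • x)) :=
    (hGi.comp_smul (by norm_num)).const_mul _
  have hb : ∀ x, rexp ⟪η, x⟫ / laplace P η * p x * (√(p x))⁻¹ ≤
      (laplace P η * √(p 0))⁻¹ * G ((2:ℝ)⁻¹ • x) := by
    intro x
    have h1 := sqrt_le_sqrt (h.logConcave.mul_le_sq 0 x)
    rw [sqrt_mul h0.le, sqrt_sq (h.logConcave.1 _), zero_add] at h1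
    have h2 : p x * (√(p x))⁻¹ = √(p x) := by
      rw [← div_eq_mul_inv, div_sqrt]
    have h3 : √(p x) ≤ p ((2:ℝ)⁻¹ • x) / √(p 0) := by
      rw [le_div_iff₀ (sqrt_pos.2 h0)]; linarith
    have h4 : ⟪(2 : ℝ) • η, (2:ℝ)⁻¹ • x⟫ = ⟪η, x⟫ := by
      rw [inner_smul_left, inner_smul_right]; simp
    rw [mul_assoc, h2, hG]
    simp only [h4]
    calc rexp ⟪η, x⟫ / laplace P η * √(p x)
        ≤ rexp ⟪η, x⟫ / laplace P η * (p ((2:ℝ)⁻¹ • x) / √(p 0)) := by gcongr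
      _ = _ := by
        have := (sqrt_pos.2 h0).ne'
        field_simp
  have hnn : ∀ x, 0 ≤ rexp ⟪η, x⟫ / laplace P η * p x * (√(p x))⁻¹ := fun x =>
    mul_nonneg (hη.logConcave.1 x) (by positivity)
  have hi : Integrable (fun x => rexp ⟪η, x⟫ / laplace P η * p x * (√(p x))⁻¹) := by
    refine hGi2.mono' ?_ (Eventually.of_forall fun x => ?_)
    · exact (hη.logConcave.aemeasurable.mul
        (h.logConcave.aemeasurable.sqrt.inv)).aestronglyMeasurable
    · rw [Real.norm_of_nonneg (hnn x)]; exact hb x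
  refine ⟨hη.integrable_iff.2 hi, ?_⟩
  rw [hη.integral_eq]
  refine (integral_mono hi hGi2 hb).trans (le_of_eq ?_)
  rw [integral_const_mul, Measure.integral_comp_inv_smul, hGe]
  simp only [finrank_euclideanSpace, Fintype.card_fin, smul_eq_mul, abs_pow]
  rw [abs_of_pos (by norm_num : (0:ℝ) < 2)]
  ring

lemma bary_mem_closure (h : IsCompactLogConcave P p ρ) (h0 : 0 < p 0) (η : EucSp n) {M : ℝ}
    (hM : 2 ^ n * laplace P ((2 : ℝ) • η) / (laplace P η * √(p 0)) < M) :
    bary (_root_.expTilt P η) ∈ closure {x | (M ^ 2)⁻¹ ≤ p x} := by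
  have hη := h.expTilt η
  have := hη.prob
  obtain ⟨hi, hle⟩ := h.integral_inv_sqrt_le h0 η
  set m := ∫ x, (√(p x))⁻¹ ∂(_root_.expTilt P η) with hm
  have hi2 : Integrable (fun x : EucSp n => x) (_root_.expTilt P η) := hη.integrable continuous_id
  have key : ((bary (_root_.expTilt P η), m) : EucSp n × ℝ) ∈
      closure {z : EucSp n × ℝ | 0 < z.2 ∧ 1 ≤ z.2 ^ 2 * p z.1} := by
    rw [bary, hm, ← integral_pair hi2 hi]
    refine h.logConcave.convex_epigraph.closure.integral_mem isClosed_closure ?_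
      (hi2.prodMk hi)
    filter_upwards [hη.ae_pos] with x hx
    have hx : 0 < p x := by
      refine lt_of_le_of_ne (h.logConcave.1 x) fun h0 => ?_
      rw [← h0, mul_zero] at hx
      exact lt_irrefl _ hx
    refine subset_closure ⟨by positivity, ?_⟩
    simp only [inv_pow, sq_sqrt hx.le]
    rw [inv_mul_cancel₀ hx.ne']
  have ho : IsOpen {z : EucSp n × ℝ | z.2 < M} := isOpen_lt continuous_snd continuous_const
  have key2 := ho.inter_closure ⟨(hle.trans_lt hM : m < M), key⟩
  have key3 := image_closure_subset_closure_image (continuous_fst (X := EucSp n) (Y := ℝ))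
    (mem_image_of_mem _ key2)
  refine closure_mono ?_ key3
  rintro _ ⟨⟨x, s⟩, ⟨hsM, hs, hx⟩, rfl⟩
  simp only [mem_ofPred_eq] at hsM hs hx ⊢
  have hM0 : 0 < M := hs.trans hsM
  have : s ^ 2 ≤ M ^ 2 := pow_le_pow_left₀ hs.le hsM.le 2
  rw [inv_le_iff_one_le_mul₀' (by positivity)]
  exact hx.trans (mul_le_mul_of_nonneg_right this (h.logConcave.1 x))

lemma volume_closure_superlevel_le (h : IsCompactLogConcave P p ρ) {c : ℝ} (hc : 0 < c) :
    volume (closure {x | c ≤ p x}) ≤ ENNReal.ofReal c⁻¹ := by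
  have := h.prob
  have h1 : volume (closure {x | c ≤ p x}) ≤ volume {x | c ≤ p x} := by
    rw [closure_eq_self_union_frontier]
    refine (measure_union_le _ _).trans ?_
    rw [(h.logConcave.convex_superlevel hc).addHaar_frontier volume, add_zero]
  have h2 := mul_meas_ge_le_lintegral₀ (μ := volume)
    h.logConcave.aemeasurable.ennreal_ofReal (ENNReal.ofReal c)
  have h3 : ∫⁻ x, ENNReal.ofReal (p x) = 1 := by
    have h4 : P univ = 1 := measure_univ
    rw [h.eq_withDensity, withDensity_apply _ MeasurableSet.univ, setLIntegral_univ] at h4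
    exact h4
  have h5 : {x | ENNReal.ofReal c ≤ ENNReal.ofReal (p x)} = {x | c ≤ p x} := by
    ext x
    exact ENNReal.ofReal_le_ofReal_iff (h.logConcave.1 x)
  rw [h3, h5] at h2
  rw [ENNReal.ofReal_inv_of_pos hc]
  refine h1.trans ?_
  rw [← one_div, ENNReal.le_div_iff_mul_le (by simp [hc]) (by simp)]
  rwa [mul_comm]

end IsCompactLogConcave

lemma integrable_exp_neg_mul_norm_sq {n : ℕ} {β : ℝ} (hβ : 0 < β) :
    Integrable fun ξ : EucSp n => rexp (-β * ‖ξ‖ ^ 2) := by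
  by_contra h
  have h1 := GaussianFourier.integral_rexp_neg_mul_sq_norm (V := EucSp n) hβ
  rw [integral_undef h] at h1
  have : 0 < (π / β) ^ ((Module.finrank ℝ (EucSp n) : ℝ) / 2) := by positivity
  linarith

lemma exp_neg_mul_norm_sq_add_inner {n : ℕ} {β : ℝ} (hβ : 0 < β) (y ξ : EucSp n) :
    rexp (-β * ‖ξ‖ ^ 2) * rexp (2 * ⟪ξ, y⟫) =
      rexp (‖y‖ ^ 2 / β) * rexp (-β * ‖ξ - β⁻¹ • y‖ ^ 2) := by
  rw [← exp_add, ← exp_add, norm_sub_sq_real, inner_smul_right, norm_smul, norm_inv,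
    Real.norm_of_nonneg hβ.le]
  congr 1
  field_simp
  ring

lemma integral_exp_neg_mul_norm_sq_add_inner {n : ℕ} {β : ℝ} (hβ : 0 < β) (y : EucSp n) :
    ∫ ξ : EucSp n, rexp (-β * ‖ξ‖ ^ 2) * rexp (2 * ⟪ξ, y⟫) =
      (∫ ξ : EucSp n, rexp (-β * ‖ξ‖ ^ 2)) * rexp (‖y‖ ^ 2 / β) := by
  simp_rw [exp_neg_mul_norm_sq_add_inner hβ y]
  rw [integral_const_mul,
    integral_sub_right_eq_self (fun ξ : EucSp n => rexp (-β * ‖ξ‖ ^ 2)), mul_comm]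

lemma integral_exp_inner_sub {n : ℕ} (P : Measure (EucSp n)) (b ξ : EucSp n) :
    ∫ x, rexp (2 * ⟪ξ, x - b⟫) ∂P = laplace P ((2:ℝ) • ξ) * rexp (-(2 * ⟪b, ξ⟫)) := by
  rw [laplace, ← integral_mul_const]
  refine integral_congr_ae (Eventually.of_forall fun x => ?_)
  simp only
  rw [← exp_add, inner_sub_right, inner_smul_left, real_inner_comm b]
  simp
  ring

namespace IsCompactLogConcave

variable {n : ℕ} {P : Measure (EucSp n)} {p : EucSp n → ℝ} {ρ : ℝ}

lemma continuous_laplace (h : IsCompactLogConcave P p ρ) : Continuous (laplace P) := by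
  have h1 : Differentiable ℝ fun ξ => ∫ x, rexp ⟪ξ, x⟫ * (1 : ℝ) ∂P := fun ξ =>
    (h.hasFDerivAt_integral_exp_mul (g := fun _ => 1) continuous_const ξ).differentiableAt
  have h2 : laplace P = fun ξ => ∫ x, rexp ⟪ξ, x⟫ * (1 : ℝ) ∂P := by
    ext ξ; simp [laplace]
  rw [h2]
  exact h1.continuous

lemma integrable_gaussian_mul (h : IsCompactLogConcave P p ρ) {β : ℝ} (hβ : 0 < β)
    (b : EucSp n) (hb : ‖b‖ ≤ ρ) : Integrable (fun z : EucSp n × EucSp n =>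
      rexp (-β * ‖z.1‖ ^ 2) * rexp (2 * ⟪z.1, z.2 - b⟫)) (volume.prod P) := by
  have := h.prob
  have h1 : Integrable (fun z : EucSp n × EucSp n =>
      rexp (8 * ρ ^ 2 / β) * rexp (-(β / 2) * ‖z.1‖ ^ 2) * 1) (volume.prod P) :=
    ((integrable_exp_neg_mul_norm_sq (by positivity)).const_mul _).mul_prod (integrable_const _)
  refine h1.mono' (Continuous.aestronglyMeasurable (by fun_prop)) ?_
  have h2 : ∀ᵐ z ∂((volume : Measure (EucSp n)).prod P), ‖z.2‖ ≤ ρ :=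
    Measure.quasiMeasurePreserving_snd.ae h.ae_norm_le
  filter_upwards [h2] with z hz
  rw [Real.norm_of_nonneg (by positivity), ← exp_add, mul_one, ← exp_add, exp_le_exp]
  have h3 : ⟪z.1, z.2 - b⟫ ≤ ‖z.1‖ * (2 * ρ) := by
    refine (real_inner_le_norm _ _).trans ?_
    have := norm_sub_le z.2 b
    gcongr
    linarith
  have h4 : 0 ≤ (4 * ρ - β * ‖z.1‖) ^ 2 / (2 * β) := by positivity
  have h5 : (4 * ρ - β * ‖z.1‖) ^ 2 / (2 * β) =
    8 * ρ ^ 2 / β - 4 * ρ * ‖z.1‖ + β / 2 * ‖z.1‖ ^ 2 := by field_simp; ring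
  rw [h5] at h4
  linarith

lemma integral_gaussian_mul_laplace_le (h : IsCompactLogConcave P p ρ) {β : ℝ}
    (hβ : 0 < β) (b : EucSp n) (hb : ‖b‖ ≤ ρ) :
    Integrable (fun ξ => rexp (-β * ‖ξ‖ ^ 2) *
      (laplace P ((2:ℝ) • ξ) * rexp (-(2 * ⟪b, ξ⟫)))) ∧
    ∫ ξ, rexp (-β * ‖ξ‖ ^ 2) * (laplace P ((2:ℝ) • ξ) * rexp (-(2 * ⟪b, ξ⟫))) ≤
      (∫ ξ : EucSp n, rexp (-β * ‖ξ‖ ^ 2)) * rexp (4 * ρ ^ 2 / β) := by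
  have := h.prob
  have hi := h.integrable_gaussian_mul hβ b hb
  have e : ∀ ξ, rexp (-β * ‖ξ‖ ^ 2) * (laplace P ((2:ℝ) • ξ) * rexp (-(2 * ⟪b, ξ⟫))) =
      ∫ x, rexp (-β * ‖ξ‖ ^ 2) * rexp (2 * ⟪ξ, x - b⟫) ∂P := by
    intro ξ
    rw [integral_const_mul, integral_exp_inner_sub]
  simp_rw [e]
  refine ⟨hi.integral_prod_left, ?_⟩
  rw [integral_integral_swap (f := fun ξ x => rexp (-β * ‖ξ‖ ^ 2) * rexp (2 * ⟪ξ, x - b⟫)) hi]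
  have hle : ∀ᵐ x ∂P, ∫ ξ, rexp (-β * ‖ξ‖ ^ 2) * rexp (2 * ⟪ξ, x - b⟫) ≤
      (∫ ξ : EucSp n, rexp (-β * ‖ξ‖ ^ 2)) * rexp (4 * ρ ^ 2 / β) := by
    filter_upwards [h.ae_norm_le] with x hx
    rw [integral_exp_neg_mul_norm_sq_add_inner hβ]
    have h1 : ‖x - b‖ ^ 2 ≤ 4 * ρ ^ 2 := by
      have := norm_sub_le x b
      have h2 : ‖x - b‖ ≤ 2 * ρ := by linarith
      calc ‖x - b‖ ^ 2 ≤ (2 * ρ) ^ 2 := pow_le_pow_left₀ (norm_nonneg _) h2 2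
        _ = _ := by ring
    have : 0 ≤ ∫ ξ : EucSp n, rexp (-β * ‖ξ‖ ^ 2) := integral_nonneg fun _ => (exp_pos _).le
    gcongr
  have := integral_mono_ae hi.integral_prod_right (integrable_const _) hle
  simpa using this

lemma measurableSet_laplace_le (h : IsCompactLogConcave P p ρ) (r T : ℝ) (b : EucSp n) :
    MeasurableSet {ξ : EucSp n |
      laplace P ((2:ℝ) • ξ) ≤ rexp (r + 2 * ⟪b, ξ⟫) ∧ ‖ξ‖ ≤ T} := by
  have c1 : IsClosed {ξ : EucSp n | laplace P ((2:ℝ) • ξ) ≤ rexp (r + 2 * ⟪b, ξ⟫)} :=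
    isClosed_le (h.continuous_laplace.comp (continuous_const_smul _)) (by fun_prop)
  have c2 : IsClosed {ξ : EucSp n | ‖ξ‖ ≤ T} := isClosed_le continuous_norm continuous_const
  exact (c1.inter c2).measurableSet

lemma half_le_volume (h : IsCompactLogConcave P p ρ) (hb : ‖bary P‖ ≤ ρ)
    {β r T : ℝ} (hβ : 0 < β) (hr : 0 < r) (hβr : 4 * ρ ^ 2 / β ≤ r / 4) (hT : 0 ≤ T)
    (hT2 : n + 2 ≤ β * T ^ 2 / 2) :
    (π / β) ^ ((n : ℝ) / 2) / 2 ≤ (volume {ξ : EucSp n |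
      laplace P ((2:ℝ) • ξ) ≤ rexp (r + 2 * ⟪bary P, ξ⟫) ∧ ‖ξ‖ ≤ T}).toReal := by
  have := h.prob
  set b := bary P with hbdef
  set S := {ξ : EucSp n | laplace P ((2:ℝ) • ξ) ≤ rexp (r + 2 * ⟪b, ξ⟫) ∧ ‖ξ‖ ≤ T} with hS
  have hSm : MeasurableSet S := h.measurableSet_laplace_le _ _ _
  have hSf : volume S ≠ ⊤ := by
    refine ((measure_mono (t := Metric.closedBall (0 : EucSp n) T) fun ξ hξ => ?_).trans_lt
      (isCompact_closedBall _ _).measure_lt_top).ne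
    simpa using hξ.2
  obtain ⟨hi1, hle1⟩ := h.integral_gaussian_mul_laplace_le hβ b hb
  set W := ∫ ξ : EucSp n, rexp (-β * ‖ξ‖ ^ 2) with hW
  have hWe : W = (π / β) ^ ((n : ℝ) / 2) := by
    rw [hW, GaussianFourier.integral_rexp_neg_mul_sq_norm hβ]
    simp
  have hW0 : 0 < W := by rw [hWe]; positivity
  have hWi := integrable_exp_neg_mul_norm_sq (n := n) hβ
  have hW2 : ∫ ξ : EucSp n, rexp (-(β / 2) * ‖ξ‖ ^ 2) = W * 2 ^ ((n : ℝ) / 2) := by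
    rw [hWe, GaussianFourier.integral_rexp_neg_mul_sq_norm (by positivity),
      ← mul_rpow (by positivity) (by norm_num)]
    simp only [finrank_euclideanSpace, Fintype.card_fin]
    congr 1
    field_simp
  have hW2i := integrable_exp_neg_mul_norm_sq (n := n) (β := β / 2) (by positivity)
  have hr1 : 0 < rexp r - 1 := by
    have := add_one_le_exp r; linarith
  set E : EucSp n → ℝ := fun ξ => laplace P ((2:ℝ) • ξ) * rexp (-(2 * ⟪b, ξ⟫)) with hE
  have hE1 : ∀ ξ, 1 ≤ E ξ := by
    intro ξ
    have h1 := h.exp_inner_bary_le ((2:ℝ) • ξ)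
    rw [inner_smul_right] at h1
    calc (1:ℝ) = rexp (2 * ⟪b, ξ⟫) * rexp (-(2 * ⟪b, ξ⟫)) := by rw [← exp_add]; simp
      _ ≤ E ξ := mul_le_mul_of_nonneg_right h1 (exp_pos _).le
  have hmain : ∀ ξ, rexp (-β * ‖ξ‖ ^ 2) ≤ S.indicator (fun _ => (1:ℝ)) ξ +
      ((rexp r - 1)⁻¹ * (rexp (-β * ‖ξ‖ ^ 2) * E ξ - rexp (-β * ‖ξ‖ ^ 2)) +
      rexp (-(β * T ^ 2 / 2)) * rexp (-(β / 2) * ‖ξ‖ ^ 2)) := by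
    intro ξ
    have hw := exp_pos (-β * ‖ξ‖ ^ 2)
    have p1 : 0 ≤ (rexp r - 1)⁻¹ * (rexp (-β * ‖ξ‖ ^ 2) * E ξ - rexp (-β * ‖ξ‖ ^ 2)) := by
      have := hE1 ξ
      refine mul_nonneg (inv_nonneg.2 hr1.le) ?_
      nlinarith
    have p2 : 0 ≤ rexp (-(β * T ^ 2 / 2)) * rexp (-(β / 2) * ‖ξ‖ ^ 2) := by positivity
    by_cases hξ : ξ ∈ S
    · rw [indicator_of_mem hξ]
      have : rexp (-β * ‖ξ‖ ^ 2) ≤ 1 := exp_le_one_iff.2 (by nlinarith [sq_nonneg ‖ξ‖])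
      linarith
    · rw [indicator_of_notMem hξ]
      by_cases hξT : ‖ξ‖ ≤ T
      · have h1 : rexp r ≤ E ξ := by
          by_contra hlt
          refine hξ ⟨?_, hξT⟩
          rw [exp_add, ← div_le_iff₀ (exp_pos _), div_eq_mul_inv, ← exp_neg]
          exact (not_le.1 hlt).le
        have h2 : rexp (-β * ‖ξ‖ ^ 2) ≤
            (rexp r - 1)⁻¹ * (rexp (-β * ‖ξ‖ ^ 2) * E ξ - rexp (-β * ‖ξ‖ ^ 2)) := by
          rw [le_inv_mul_iff₀ hr1]
          nlinarith
        linarith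
      · have h2 : rexp (-β * ‖ξ‖ ^ 2) ≤ rexp (-(β * T ^ 2 / 2)) * rexp (-(β / 2) * ‖ξ‖ ^ 2) := by
          rw [← exp_add, exp_le_exp]
          have : T ^ 2 ≤ ‖ξ‖ ^ 2 := pow_le_pow_left₀ hT (not_le.1 hξT).le 2
          nlinarith
        linarith
  have hSi : Integrable (S.indicator fun _ => (1:ℝ)) (volume : Measure (EucSp n)) :=
    (integrable_indicator_iff hSm).2 (integrableOn_const hSf)
  have hA : Integrable (fun ξ : EucSp n => (rexp r - 1)⁻¹ *
      (rexp (-β * ‖ξ‖ ^ 2) * E ξ - rexp (-β * ‖ξ‖ ^ 2))) := (hi1.sub hWi).const_mul _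
  have hB : Integrable (fun ξ : EucSp n => rexp (-(β * T ^ 2 / 2)) * rexp (-(β / 2) * ‖ξ‖ ^ 2)) :=
    hW2i.const_mul _
  have h_int := integral_mono hWi (hSi.add (hA.add hB)) hmain
  have h_int3 : W ≤ (volume S).toReal + ((rexp r - 1)⁻¹ * ((∫ ξ, rexp (-β * ‖ξ‖ ^ 2) * E ξ) - W) +
        rexp (-(β * T ^ 2 / 2)) * (W * 2 ^ ((n : ℝ) / 2))) := by
    rw [integral_add' hSi (hA.add hB), integral_add' hA hB, integral_indicator hSm,
      integral_const_mul, integral_const_mul, integral_sub hi1 hWi, hW2] at h_int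
    have hs : ∫ _ in S, (1:ℝ) = (volume S).toReal := by simp [Measure.real]
    rw [hs] at h_int
    exact h_int
  have b1 : (rexp r - 1)⁻¹ * ((∫ ξ, rexp (-β * ‖ξ‖ ^ 2) * E ξ) - W) ≤ W / 4 := by
    rw [inv_mul_le_iff₀ hr1]
    have h1 : rexp (4 * ρ ^ 2 / β) ≤ 1 + (rexp r - 1) / 4 := by
      have h2 := convexOn_exp.2 (mem_univ (0:ℝ)) (mem_univ r) (by norm_num : (0:ℝ) ≤ 3 / 4)
        (by norm_num : (0:ℝ) ≤ 1 / 4) (by norm_num)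
      simp only [smul_eq_mul, mul_zero, zero_add, exp_zero, mul_one] at h2
      have h3 : rexp (4 * ρ ^ 2 / β) ≤ rexp (1 / 4 * r) := exp_le_exp.2 (by linarith)
      linarith
    have h2 : W * rexp (4 * ρ ^ 2 / β) ≤ W * (1 + (rexp r - 1) / 4) :=
      mul_le_mul_of_nonneg_left h1 hW0.le
    linarith
  have b2 : rexp (-(β * T ^ 2 / 2)) * (W * 2 ^ ((n : ℝ) / 2)) ≤ W / 4 := by
    have h1 : (2:ℝ) ^ ((n : ℝ) / 2) ≤ rexp n := by
      rw [rpow_def_of_pos (by norm_num), exp_le_exp]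
      have : log 2 ≤ 1 := by linarith [log_two_lt_d9]
      have hn : (0:ℝ) ≤ n := Nat.cast_nonneg n
      nlinarith
    have h2 : rexp (-(β * T ^ 2 / 2)) ≤ rexp (-(n + 2)) := exp_le_exp.2 (by linarith)
    have h3 : rexp (-2) ≤ 1 / 4 := by
      rw [exp_neg, one_div]
      have : (4:ℝ) ≤ rexp 2 := by
        have e : rexp 2 = rexp 1 * rexp 1 := by rw [← exp_add]; norm_num
        have := exp_one_gt_d9
        nlinarith
      exact inv_anti₀ (by norm_num) this
    calc rexp (-(β * T ^ 2 / 2)) * (W * 2 ^ ((n : ℝ) / 2)) ≤ rexp (-(n + 2)) * (W * rexp n) := by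
          gcongr
      _ = W * rexp (-2) := by
          rw [mul_left_comm, ← exp_add]; congr 2; ring
      _ ≤ W / 4 := by nlinarith
  rw [← hWe]
  linarith

end IsCompactLogConcave

lemma IsIsotropic.apply_zero_le {n : ℕ} {μ : Measure (EucSp n)} {f : EucSp n → ℝ}
    [IsProbabilityMeasure μ] (h : IsIsotropic μ) (hn : 1 ≤ n) (hf : IsLogConcaveFn f)
    (hμ : μ = volume.withDensity fun x => ENNReal.ofReal (f x)) (hσ : 1 / 2 ≤ sigmaN n ^ 2) :
    f 0 ≤ (64 * rexp 5 * 100000 * sigmaN n) ^ n := by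
  have hσ0 : 0 < sigmaN n := by
    refine lt_of_le_of_ne (sigmaN_nonneg n) fun h0 => ?_
    rw [← h0] at hσ
    norm_num at hσ
  have hn1 : (1:ℝ) ≤ n := by exact_mod_cast hn
  have hn0 : (0:ℝ) < n := by linarith
  obtain ⟨P, p, hP, hfp, hb, hvar⟩ := h.exists_truncation hn hf hμ
  refine hfp.trans ?_
  rcases (hP.logConcave.1 0).eq_or_lt with h0 | h0
  · rw [← h0]; positivity
  change ‖bary P‖ ≤ 1 at hb
  set σ := sigmaN n with hσdef
  set r : ℝ := n / (62500 * σ ^ 2) with hr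
  have hr0 : 0 < r := by positivity
  have hrn : r ≤ n := by
    rw [hr, div_le_iff₀ (by positivity)]
    nlinarith
  have hr2 : r * (62500 * σ ^ 2) ≤ n := by
    rw [hr]
    exact (div_mul_cancel₀ _ (by positivity)).le
  set β : ℝ := (100000 * σ) ^ 2 with hβ
  have hβ0 : 0 < β := by positivity
  have hsq : √(n:ℝ) ^ 2 = n := sq_sqrt hn0.le
  have hb2 : ‖bary P‖ ≤ 100 * √(n:ℝ) := by
    have : 1 ≤ √(n:ℝ) := one_le_sqrt.2 hn1
    linarith
  have hβr : 4 * (100 * √(n:ℝ)) ^ 2 / β ≤ r / 4 := by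
    rw [mul_pow, hsq, hβ, hr]
    refine le_of_eq ?_
    field_simp
    norm_num
  have hT : (n:ℝ) + 2 ≤ β * (n:ℝ) ^ 2 / 2 := by
    have : 10000 ≤ β := by rw [hβ]; nlinarith
    nlinarith
  have hvol := hP.half_le_volume hb2 hβ0 hr0 hβr hn0.le hT
  set S := {ξ : EucSp n | laplace P ((2:ℝ) • ξ) ≤ rexp (r + 2 * ⟪bary P, ξ⟫) ∧ ‖ξ‖ ≤ n} with hS
  have hdet : ∀ ξ ∈ S, ((2 * rexp 1)⁻¹) ^ n ≤ (covMat (expTilt P ξ)).det := fun ξ hξ =>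
    hP.log_det_covMat_expTilt_ge_neg hn hvar ξ hr0 hr2 hξ.1
  have h1 := hP.mul_volume_le_volume_image_bary (hP.measurableSet_laplace_le r n (bary P)) hdet
  set M : ℝ := 2 * (2 ^ n * rexp (2 * n) / √(p 0)) with hM
  have hp0 : 0 < √(p 0) := sqrt_pos.2 h0
  have hM0 : 0 < M := by positivity
  have h2 : Set.image (fun ξ => bary (expTilt P ξ)) S ⊆ closure {x | (M ^ 2)⁻¹ ≤ p x} := by
    rintro _ ⟨η, hη, rfl⟩
    refine hP.bary_mem_closure h0 η ?_
    have e1 : ⟪bary P, η⟫ ≤ n := by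
      refine (real_inner_le_norm _ _).trans ?_
      have := hη.2
      calc ‖bary P‖ * ‖η‖ ≤ 1 * n := by gcongr
        _ = n := one_mul _
    have e2 : laplace P ((2:ℝ) • η) / laplace P η ≤ rexp (2 * n) := by
      rw [div_le_iff₀ (hP.laplace_pos η)]
      calc laplace P ((2:ℝ) • η) ≤ rexp (r + 2 * ⟪bary P, η⟫) := hη.1
        _ ≤ rexp (2 * n) * rexp ⟪bary P, η⟫ := by
          rw [← exp_add, exp_le_exp]; linarith
        _ ≤ rexp (2 * n) * laplace P η := by
          gcongr
          exact hP.exp_inner_bary_le η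
    calc 2 ^ n * laplace P ((2:ℝ) • η) / (laplace P η * √(p 0))
        = 2 ^ n * (laplace P ((2:ℝ) • η) / laplace P η) / √(p 0) := by
          have := (hP.laplace_pos η).ne'
          field_simp
      _ ≤ 2 ^ n * rexp (2 * n) / √(p 0) := by gcongr
      _ < M := by
          have : 0 < 2 ^ n * rexp (2 * n) / √(p 0) := by positivity
          linarith
  have h3 := hP.volume_closure_superlevel_le (c := (M ^ 2)⁻¹) (by positivity)
  rw [inv_inv] at h3
  have h4 := ENNReal.toReal_mono ENNReal.ofReal_ne_top ((h1.trans (measure_mono h2)).trans h3)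
  rw [ENNReal.toReal_mul, ENNReal.toReal_ofReal (by positivity),
    ENNReal.toReal_ofReal (by positivity)] at h4
  have h5 : ((100000 * σ)⁻¹) ^ n ≤ (π / β) ^ ((n:ℝ) / 2) := by
    have e1 : ((100000 * σ)⁻¹) ^ n = (1 / β) ^ ((n:ℝ) / 2) := by
      rw [hβ, one_div, ← inv_pow, ← rpow_natCast (_⁻¹) 2, ← rpow_mul (by positivity),
        ← rpow_natCast]
      congr 1
      push_cast
      ring
    rw [e1]
    refine rpow_le_rpow (by positivity) ?_ (by positivity)
    gcongr
    linarith [pi_gt_three]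
  have h6 : ((2 * rexp 1)⁻¹) ^ n * (((100000 * σ)⁻¹) ^ n / 2) ≤ M ^ 2 :=
    le_trans (mul_le_mul_of_nonneg_left (by linarith) (by positivity)) h4
  have h7 : M ^ 2 = 4 * (4 * rexp 4) ^ n / p 0 := by
    have e1 : rexp (2 * n) ^ 2 = rexp 4 ^ n := by
      rw [← exp_nat_mul, ← exp_nat_mul]; congr 1; push_cast; ring
    have e2 : ((2:ℝ) ^ n) ^ 2 = 4 ^ n := by
      rw [← pow_mul, mul_comm, pow_mul]; norm_num
    rw [hM, mul_pow, div_pow, sq_sqrt h0.le, mul_pow, e1, e2, mul_pow]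
    ring
  rw [h7, le_div_iff₀ h0, inv_pow, inv_pow] at h6
  have h8 : p 0 ≤ 8 * ((4 * rexp 4) ^ n * (2 * rexp 1) ^ n * (100000 * σ) ^ n) := by
    have a1 : 0 < (2 * rexp 1) ^ n := by positivity
    have a2 : 0 < (100000 * σ) ^ n := by positivity
    have e : ((2 * rexp 1) ^ n)⁻¹ * (((100000 * σ) ^ n)⁻¹ / 2) * p 0 =
        p 0 / (2 * (2 * rexp 1) ^ n * (100000 * σ) ^ n) := by field_simp
    rw [e, div_le_iff₀ (by positivity)] at h6
    linarith
  refine h8.trans ?_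
  have h9 : (8:ℝ) ≤ 8 ^ n := le_self_pow₀ (by norm_num) (by omega)
  calc 8 * ((4 * rexp 4) ^ n * (2 * rexp 1) ^ n * (100000 * σ) ^ n)
      ≤ 8 ^ n * ((4 * rexp 4) ^ n * (2 * rexp 1) ^ n * (100000 * σ) ^ n) := by gcongr
    _ = (64 * rexp 5 * 100000 * σ) ^ n := by
      rw [← mul_pow, ← mul_pow, ← mul_pow]
      congr 1
      have : rexp 5 = rexp 4 * rexp 1 := by rw [← exp_add]; norm_num
      rw [this]; ring

section Radial
variable {n : ℕ} {g : ℝ → ℝ}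

lemma integral_inner_sq_mul_radial_eq {u v : EucSp n} (h : ‖u‖ = ‖v‖) :
    ∫ x : EucSp n, ⟪x, u⟫ ^ 2 * g ‖x‖ = ∫ x : EucSp n, ⟪x, v⟫ ^ 2 * g ‖x‖ := by
  set R : EucSp n ≃ₗᵢ[ℝ] EucSp n := (ℝ ∙ (u - v))ᗮ.reflection
  have hR : R u = v := Submodule.reflection_sub h
  rw [← R.measurePreserving.integral_comp R.toHomeomorph.measurableEmbedding
    (fun x : EucSp n => ⟪x, v⟫ ^ 2 * g ‖x‖)]
  refine integral_congr_ae (Eventually.of_forall fun x => ?_)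
  simp only [R.norm_map]
  rw [← hR, R.inner_map_map]

lemma integrable_inner_sq_mul_radial (hg : Measurable g) (hg0 : ∀ t, 0 ≤ g t)
    (hi : Integrable fun x : EucSp n => ‖x‖ ^ 2 * g ‖x‖) (u : EucSp n) :
    Integrable fun x : EucSp n => ⟪x, u⟫ ^ 2 * g ‖x‖ := by
  refine (hi.const_mul (‖u‖ ^ 2)).mono' ?_ (Eventually.of_forall fun x => ?_)
  · have : Measurable fun x : EucSp n => ⟪x, u⟫ := by fun_prop
    exact ((this.pow_const 2).mul (hg.comp measurable_norm)).aestronglyMeasurable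
  · rw [norm_of_nonneg (mul_nonneg (sq_nonneg _) (hg0 _)), ← mul_assoc]
    refine mul_le_mul_of_nonneg_right ?_ (hg0 _)
    rw [← mul_pow, ← sq_abs]
    refine pow_le_pow_left₀ (abs_nonneg _) ?_ 2
    rw [mul_comm]
    exact abs_real_inner_le_norm x u

lemma integral_inner_sq_mul_radial (hn : 1 ≤ n) (hg : Measurable g) (hg0 : ∀ t, 0 ≤ g t)
    (hi : Integrable fun x : EucSp n => ‖x‖ ^ 2 * g ‖x‖) (u : EucSp n) :
    ∫ x : EucSp n, ⟪x, u⟫ ^ 2 * g ‖x‖ =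
      ‖u‖ ^ 2 * ((∫ x : EucSp n, ‖x‖ ^ 2 * g ‖x‖) / n) := by
  have hn0 : (n:ℝ) ≠ 0 := by positivity
  set e := EuclideanSpace.basisFun (Fin n) ℝ
  let i₀ : Fin n := ⟨0, hn⟩
  have hsum : ∫ x : EucSp n, ‖x‖ ^ 2 * g ‖x‖ =
      n * ∫ x : EucSp n, ⟪x, e i₀⟫ ^ 2 * g ‖x‖ := by
    have h1 : ∀ x : EucSp n, ‖x‖ ^ 2 * g ‖x‖ = ∑ i, ⟪x, e i⟫ ^ 2 * g ‖x‖ := fun x => by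
      rw [← Finset.sum_mul, ← e.sum_sq_norm_inner_left x]
      simp
    simp_rw [h1]
    rw [integral_finsetSum _ fun i _ => integrable_inner_sq_mul_radial hg hg0 hi _,
      Finset.sum_congr rfl fun i _ => integral_inner_sq_mul_radial_eq (g := g)
        (u := e i) (v := e i₀) (by simp [e.norm_eq_one])]
    simp
  have hu : ‖u‖ = ‖‖u‖ • e i₀‖ := by rw [norm_smul, e.norm_eq_one]; simp
  rw [integral_inner_sq_mul_radial_eq hu, hsum, mul_div_cancel_left₀ _ hn0,
    ← integral_const_mul]
  refine integral_congr_ae (Eventually.of_forall fun x => ?_)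
  simp only [real_inner_smul_right]
  ring

lemma integral_inner_mul_inner_mul_radial (hn : 1 ≤ n) (hg : Measurable g) (hg0 : ∀ t, 0 ≤ g t)
    (hi : Integrable fun x : EucSp n => ‖x‖ ^ 2 * g ‖x‖) (u v : EucSp n) :
    ∫ x : EucSp n, ⟪x, u⟫ * ⟪x, v⟫ * g ‖x‖ =
      ⟪u, v⟫ * ((∫ x : EucSp n, ‖x‖ ^ 2 * g ‖x‖) / n) := by
  have h1 : ∀ x : EucSp n, ⟪x, u⟫ * ⟪x, v⟫ * g ‖x‖ =
      (⟪x, u + v⟫ ^ 2 * g ‖x‖ - ⟪x, u - v⟫ ^ 2 * g ‖x‖) / 4 := fun x => by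
    rw [inner_add_right, inner_sub_right]
    ring
  simp_rw [h1]
  rw [integral_div, integral_sub (integrable_inner_sq_mul_radial hg hg0 hi _)
    (integrable_inner_sq_mul_radial hg hg0 hi _), integral_inner_sq_mul_radial hn hg hg0 hi,
    integral_inner_sq_mul_radial hn hg hg0 hi, norm_add_sq_real, norm_sub_sq_real]
  ring

end Radial

section ExpNorm
variable {n : ℕ} {a : ℝ}

lemma integrable_norm_pow_mul_exp (hn : 1 ≤ n) (ha : 0 < a) (k : ℕ) :
    Integrable fun x : EucSp n => ‖x‖ ^ k * rexp (-(a * ‖x‖)) := by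
  have : Nonempty (Fin n) := ⟨⟨0, hn⟩⟩
  rw [integrable_fun_norm_addHaar volume (f := fun t => t ^ k * rexp (-(a * t)))]
  have := integrableOn_rpow_mul_exp_neg_mul_rpow (s := (n - 1 + k : ℕ)) (p := 1) (b := a)
    (by linarith [Nat.cast_nonneg (α := ℝ) (n - 1 + k)]) one_pos ha
  refine this.congr_fun (fun t _ => ?_) measurableSet_Ioi
  simp only [rpow_natCast, rpow_one, finrank_euclideanSpace_fin, smul_eq_mul, neg_mul]
  ring

lemma integral_norm_pow_mul_exp (hn : 1 ≤ n) (ha : 0 < a) (k : ℕ) :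
    ∫ x : EucSp n, ‖x‖ ^ k * rexp (-(a * ‖x‖)) =
      n * volume.real (Metric.ball (0 : EucSp n) 1) *
        ((n - 1 + k).factorial / a ^ (n + k)) := by
  have : Nonempty (Fin n) := ⟨⟨0, hn⟩⟩
  rw [integral_fun_norm_addHaar volume (fun t => t ^ k * rexp (-(a * t)))]
  have h := Real.integral_rpow_mul_exp_neg_mul_Ioi (a := (n - 1 + k : ℕ) + 1) (r := a)
    (by positivity) ha
  have h2 : ∫ t in Ioi (0:ℝ), t ^ (n - 1) * (t ^ k * rexp (-(a * t))) =
      (n - 1 + k).factorial / a ^ (n + k) := by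
    rw [Real.Gamma_nat_eq_factorial] at h
    have e : ((n - 1 + k : ℕ) : ℝ) + 1 = (n + k : ℕ) := by
      have : n - 1 + k + 1 = n + k := by omega
      exact_mod_cast this
    rw [e, rpow_natCast] at h
    have e2 : ((n + k : ℕ) : ℝ) - 1 = (n - 1 + k : ℕ) := by rw [← e]; ring
    rw [e2] at h
    simp_rw [rpow_natCast] at h
    rw [one_div, inv_pow, inv_mul_eq_div] at h
    rw [← h]
    refine integral_congr_ae (Eventually.of_forall fun t => ?_)
    simp only
    ring
  simp only [finrank_euclideanSpace_fin, smul_eq_mul, nsmul_eq_mul]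
  rw [h2]
  ring

lemma isLogConcaveFn_const_mul_exp_neg_norm {c : ℝ} (hc : 0 ≤ c) (ha : 0 ≤ a) :
    IsLogConcaveFn fun x : EucSp n => c * rexp (-(a * ‖x‖)) := by
  refine ⟨fun x => by positivity, fun x y l hl => ?_⟩
  have h1 : 0 ≤ 1 - l := by linarith [hl.2]
  have hc' : c ^ (1 - l) * c ^ l = c := by
    rw [← rpow_add_of_nonneg hc h1 hl.1]; simp
  simp only
  rw [mul_rpow hc (exp_nonneg _), mul_rpow hc (exp_nonneg _), ← exp_mul, ← exp_mul,
    mul_mul_mul_comm, hc', ← exp_add]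
  refine mul_le_mul_of_nonneg_left (exp_le_exp.2 ?_) hc
  have : ‖(1 - l) • x + l • y‖ ≤ (1 - l) * ‖x‖ + l * ‖y‖ := by
    refine (norm_add_le _ _).trans_eq ?_
    rw [norm_smul, norm_smul, norm_of_nonneg h1, norm_of_nonneg hl.1]
  nlinarith [mul_le_mul_of_nonneg_left this ha]

end ExpNorm

lemma half_le_sigmaN_sq {n : ℕ} (hn : 1 ≤ n) : 1 / 2 ≤ sigmaN n ^ 2 := by
  have : Nonempty (Fin n) := ⟨⟨0, hn⟩⟩
  have hn1 : (1:ℝ) ≤ n := by exact_mod_cast hn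
  set a : ℝ := √(n + 1) with ha_def
  have ha2 : a ^ 2 = n + 1 := sq_sqrt (by positivity)
  have ha : 0 < a := sqrt_pos.2 (by positivity)
  set V : ℝ := volume.real (Metric.ball (0 : EucSp n) 1) with hV_def
  have hV : 0 < V := by
    rw [hV_def]
    exact ENNReal.toReal_pos (Metric.measure_ball_pos _ _ one_pos).ne' measure_ball_lt_top.ne
  obtain ⟨m, rfl⟩ : ∃ m, n = m + 1 := ⟨n - 1, by omega⟩
  have I (k : ℕ) := integral_norm_pow_mul_exp hn ha k
  set Z : ℝ := ∫ x : EucSp (m + 1), ‖x‖ ^ 0 * rexp (-(a * ‖x‖)) with hZ_def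
  have hm0 : ((m + 1 : ℕ) : ℝ) ≠ 0 := by positivity
  have hZ : 0 < Z := by rw [hZ_def, I 0]; positivity
  have hI0 : ∫ x : EucSp (m + 1), rexp (-(a * ‖x‖)) = Z := by simp [hZ_def]
  have hI1 : ∫ x : EucSp (m + 1), ‖x‖ ^ 1 * rexp (-(a * ‖x‖)) = Z * ((m + 1 : ℕ) / a) := by
    rw [I 1, hZ_def, I 0]
    simp only [Nat.add_sub_cancel, add_zero, Nat.factorial_succ, pow_succ]
    push_cast
    field_simp
  have hI2 : ∫ x : EucSp (m + 1), ‖x‖ ^ 2 * rexp (-(a * ‖x‖)) = Z * (m + 1 : ℕ) := by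
    rw [I 2, hZ_def, I 0]
    have e : a ^ (m + 1 + 2) = a ^ (m + 1) * ((m + 1 : ℕ) + 1) := by rw [pow_add, ha2]
    rw [e]
    simp only [Nat.add_sub_cancel, add_zero, Nat.factorial_succ]
    push_cast
    field_simp
  set f : EucSp (m + 1) → ℝ := fun x => Z⁻¹ * rexp (-(a * ‖x‖)) with hf_def
  have hf : IsLogConcaveFn f := isLogConcaveFn_const_mul_exp_neg_norm (inv_pos.2 hZ).le ha.le
  set μ : Measure (EucSp (m + 1)) := volume.withDensity fun x => ENNReal.ofReal (f x) with hμ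
  have hfm : Measurable f := by fun_prop
  have hfi : Integrable f := by
    simpa using (integrable_norm_pow_mul_exp hn ha 0).const_mul Z⁻¹
  have h_int {F : Type} [NormedAddCommGroup F] [NormedSpace ℝ F] (φ : EucSp (m + 1) → F) :
      ∫ x, φ x ∂μ = ∫ x, f x • φ x := by
    rw [hμ, integral_withDensity_eq_integral_toReal_smul hfm.ennreal_ofReal
      (Eventually.of_forall fun x => ENNReal.ofReal_lt_top)]
    exact integral_congr_ae (Eventually.of_forall fun x => by
      simp only [ENNReal.toReal_ofReal (hf.1 x)])
  have : IsProbabilityMeasure μ := by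
    refine ⟨?_⟩
    rw [hμ, withDensity_apply _ MeasurableSet.univ, Measure.restrict_univ,
      ← ofReal_integral_eq_lintegral_ofReal hfi (Eventually.of_forall hf.1), hf_def,
      integral_const_mul, hI0, inv_mul_cancel₀ hZ.ne', ENNReal.ofReal_one]
  have hiso : IsIsotropic μ := by
    constructor
    · rw [h_int]
      have := integral_neg_eq_self (fun x : EucSp (m + 1) => f x • x) volume
      simp only [hf_def, norm_neg, smul_neg, integral_neg] at this ⊢
      refine (smul_eq_zero_iff_right (two_ne_zero (α := ℝ))).1 ?_
      rw [two_smul]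
      nth_rewrite 1 [← this]
      exact neg_add_cancel _
    · intro u v
      rw [h_int]
      have := integral_inner_mul_inner_mul_radial (g := fun t => rexp (-(a * t))) hn
        (by fun_prop) (fun t => (exp_pos _).le) (integrable_norm_pow_mul_exp hn ha 2) u v
      simp only [hI2, mul_div_cancel_right₀ _ hm0] at this
      have e : ∀ x : EucSp (m + 1), f x • (⟪x, u⟫ * ⟪x, v⟫) =
          Z⁻¹ * (⟪x, u⟫ * ⟪x, v⟫ * rexp (-(a * ‖x‖))) := fun x => by
        simp only [hf_def, smul_eq_mul]; ring
      simp_rw [e]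
      rw [integral_const_mul, this]
      field_simp
  have hE : ∫ x, ‖x‖ ∂μ = (m + 1 : ℕ) / a := by
    rw [h_int]
    have e : ∀ x : EucSp (m + 1), f x • ‖x‖ = Z⁻¹ * (‖x‖ ^ 1 * rexp (-(a * ‖x‖))) := fun x => by
      simp only [hf_def, smul_eq_mul]; ring
    simp_rw [e]
    rw [integral_const_mul, hI1]
    field_simp
  have hle := hiso.integral_thinShell_le_sigmaNSq ⟨f, hf, hμ⟩
  rw [hiso.integral_thinShell, hE] at hle
  rw [sigmaN_sq]
  refine le_trans ?_ hle
  set N : ℝ := ((m + 1 : ℕ) : ℝ)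
  have hs : √N ^ 2 = N := sq_sqrt (by positivity)
  have hs0 : 0 < √N := sqrt_pos.2 (by positivity)
  have key : √N * a ≤ N + 1 / 2 := by nlinarith [sq_nonneg (a - √N)]
  have : 2 * √N * (N / a) = 2 * N * (√N * a) / (N + 1) := by
    rw [← ha2]; field_simp
  rw [this, le_sub_iff_add_le, ← le_sub_iff_add_le', div_le_iff₀ (by positivity)]
  nlinarith [mul_le_mul_of_nonneg_left key (by positivity : 0 ≤ 2 * N)]

/-- There exists a universal constant C > 0 such that for every dimension n ≥ 1,
L_n ≤ C σ_n. -/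
theorem hyperplane_conjecture_from_thin_shell :
    ∃ C : ℝ, 0 < C ∧ ∀ n : ℕ, 1 ≤ n → LN n ≤ C * sigmaN n := by
  refine ⟨64 * rexp 5 * 100000, by positivity, fun n hn => ?_⟩
  have hC : 0 ≤ 64 * rexp 5 * 100000 * sigmaN n := by
    have := sigmaN_nonneg n
    positivity
  refine Real.sSup_le ?_ hC
  rintro _ ⟨μ, f, hP, hiso, hf, hμ, rfl⟩
  refine (rpow_le_rpow (hf.1 0)
    (hiso.apply_zero_le hn hf hμ (half_le_sigmaN_sq hn)) (by positivity)).trans_eq ?_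
  exact Real.pow_rpow_inv_natCast hC (by omega)
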